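/- In any 3-edge-colouring of the edges of the complete graph K_ℕ on vertex set ℕ, there exists a monochromatic path P with upper density d̄(P) ≥ 1/2. -/

import Mathlib

open Filter

/-- Upper density of a set of positive integers:
`limsup_{n→∞} |A ∩ {1,…,n}| / n`. -/
noncomputable def upperDensity (A : Set ℕ+) : ℝ :=
  Filter.limsup (fun n : ℕ => (Nat.card {a : ℕ+ // a ∈ A ∧ (a : ℕ) ≤ n} : ℝ) / n) Filter.atTop

/-- Adjacency in the complete bipartite graph with parts `V` and `W`. -/
def bipAdj (V W : Set ℕ+) (x y : ℕ+) : Prop :=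
  (x ∈ V ∧ y ∈ W) ∨ (x ∈ W ∧ y ∈ V)

/-- Adjacency in the complete graph on the positive integers. -/
def completeAdj (x y : ℕ+) : Prop := x ≠ y

/-- `P` is the vertex set of a (finite or one-way infinite) path of colour `i`
in the graph with adjacency `Adj`, whose edges are coloured by `c`. -/
def IsMonoPath {k : ℕ} (Adj : ℕ+ → ℕ+ → Prop) (c : Sym2 ℕ+ → Fin k) (i : Fin k)
    (P : Set ℕ+) : Prop :=
  (∃ (n : ℕ) (f : Fin n → ℕ+), Function.Injective f ∧
    (∀ (j : ℕ) (h : j + 1 < n),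
      Adj (f ⟨j, Nat.lt_of_succ_lt h⟩) (f ⟨j + 1, h⟩) ∧
      c s(f ⟨j, Nat.lt_of_succ_lt h⟩, f ⟨j + 1, h⟩) = i) ∧
    P = Set.range f) ∨
  (∃ f : ℕ → ℕ+, Function.Injective f ∧
    (∀ j : ℕ, Adj (f j) (f (j + 1)) ∧ c s(f j, f (j + 1)) = i) ∧
    P = Set.range f)

namespace MP

/-- One step along an edge of colour `i`, landing outside `F`. -/
def Step (col : ℕ → ℕ → Fin 3) (i : Fin 3) (F : Finset ℕ) (a b : ℕ) : Prop :=
  col a b = i ∧ b ∉ F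

/-- `S` stays connected in colour `i` after deleting any finite set. -/
def Linked (col : ℕ → ℕ → Fin 3) (i : Fin 3) (S : Set ℕ) : Prop :=
  ∀ F : Finset ℕ, ∀ x ∈ S, ∀ y ∈ S, x ∉ F → y ∉ F → Relation.ReflTransGen (Step col i F) x y

/-- Edge of colour `i`, or a virtual edge inside `L`. -/
def RP (col : ℕ → ℕ → Fin 3) (i : Fin 3) (L : Set ℕ) (a b : ℕ) : Prop :=
  (a ∈ L ∧ b ∈ L) ∨ col a b = i

/-- Admissible lists. -/
structure Adm (col : ℕ → ℕ → Fin 3) (i : Fin 3) (L : Set ℕ) (F : Finset ℕ) (l : List ℕ) :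
    Prop where
  nodup : l.Nodup
  avoid : ∀ x ∈ l, x ∉ F
  chain : l.IsChain (RP col i L)
  hd : ∀ x ∈ l.head?, x ∈ L
  tl : ∀ x ∈ l.getLast?, x ∈ L

/-- Arbitrarily long admissible lists of density about one half. -/
def Good (col : ℕ → ℕ → Fin 3) (i : Fin 3) (L : Set ℕ) : Prop :=
  ∀ (F : Finset ℕ) (D N : ℕ), 1 ≤ D → ∃ n, N ≤ n ∧ ∃ l, Adm col i L F l ∧
    n ≤ 2 * (l.toFinset.filter (· < n)).card + n / D

lemma linked_of_common {col : ℕ → ℕ → Fin 3} (hs : ∀ a b, col a b = col b a) {i : Fin 3}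
    {S : Set ℕ}
    (h : ∀ x ∈ S, ∀ y ∈ S, ∀ F : Finset ℕ, ∃ w, w ∉ F ∧ col x w = i ∧ col y w = i) :
    Linked col i S := by
  intro F x hx y hy hxF hyF
  obtain ⟨w, hw, h1, h2⟩ := h x hx y hy F
  exact (Relation.ReflTransGen.single ⟨h1, hw⟩).tail ⟨by rw [hs]; exact h2, hyF⟩

lemma linked_union_of_infinite {col : ℕ → ℕ → Fin 3} (hs : ∀ a b, col a b = col b a)
    {i : Fin 3} {S T : Set ℕ} (hS : Linked col i S)
    (hT : ∀ t ∈ T, {w | w ∈ S ∧ col t w = i}.Infinite) : Linked col i (S ∪ T) := by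
  intro F
  have key : ∀ x ∈ S ∪ T, x ∉ F → ∃ w ∈ S, w ∉ F ∧ Relation.ReflTransGen (Step col i F) x w ∧
      Relation.ReflTransGen (Step col i F) w x := by
    rintro x (hx | hx) hxF
    · exact ⟨x, hx, hxF, .refl, .refl⟩
    · obtain ⟨w, hw, hwF⟩ := (hT x hx).exists_notMem_finset F
      exact ⟨w, hw.1, hwF, .single ⟨hw.2, hwF⟩, .single ⟨by rw [hs]; exact hw.2, hxF⟩⟩
  intro x hx y hy hxF hyF
  obtain ⟨w, hw, hwF, h1, -⟩ := key x hx hxF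
  obtain ⟨w', hw', hwF', -, h2⟩ := key y hy hyF
  exact (h1.trans (hS F w hw w' hw' hwF hwF')).trans h2

lemma linked_union {col : ℕ → ℕ → Fin 3} {i : Fin 3} {S T : Set ℕ} (hS : Linked col i S)
    (hT : Linked col i T) (hST : (S ∩ T).Infinite) : Linked col i (S ∪ T) := by
  intro F x hx y hy hxF hyF
  obtain ⟨z, hz, hzF⟩ := hST.exists_notMem_finset F
  rcases hx with hx | hx <;> rcases hy with hy | hy
  · exact hS F x hx y hy hxF hyF
  · exact (hS F x hx z hz.1 hxF hzF).trans (hT F z hz.2 y hy hzF hyF)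
  · exact (hT F x hx z hz.2 hxF hzF).trans (hS F z hz.1 y hy hzF hyF)
  · exact hT F x hx y hy hxF hyF

lemma Linked.mono {col : ℕ → ℕ → Fin 3} {i : Fin 3} {S T : Set ℕ} (hS : Linked col i S)
    (h : T ⊆ S) : Linked col i T :=
  fun F x hx y hy => hS F x (h hx) y (h hy)

lemma ultra_fin {α : Type*} (U : Ultrafilter α) (g : α → Fin 3) : ∃ i, ∀ᶠ a in U, g a = i := by
  obtain ⟨i, hi⟩ := (U.map g).eq_pure_of_finite
  refine ⟨i, ?_⟩
  have : ({i} : Set (Fin 3)) ∈ U.map g := by rw [hi]; simp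
  exact this

/-- Vertices whose majority colour is `i`. -/
def VV (col : ℕ → ℕ → Fin 3) (i : Fin 3) : Set ℕ := {v | ∀ᶠ w in hyperfilter ℕ, col v w = i}

lemma VV_exists (col : ℕ → ℕ → Fin 3) (v : ℕ) : ∃ i, v ∈ VV col i := ultra_fin _ _

lemma VV_unique {col : ℕ → ℕ → Fin 3} {v : ℕ} {i j : Fin 3} (h : v ∈ VV col i)
    (h' : v ∈ VV col j) : i = j := by
  obtain ⟨w, h1, h2⟩ := (Eventually.and h h').exists
  exact h1.symm.trans h2

lemma ev_exists_notMem {U : Ultrafilter ℕ} (hU : (U : Filter ℕ) ≤ cofinite) {p : ℕ → Prop}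
    (h : ∀ᶠ w in U, p w) (F : Finset ℕ) : ∃ w, w ∉ F ∧ p w := by
  have : ∀ᶠ w in (U : Filter ℕ), w ∉ F := hU F.finite_toSet.eventually_cofinite_notMem
  exact (this.and h).exists

lemma VV_linked {col : ℕ → ℕ → Fin 3} (hs : ∀ a b, col a b = col b a) (i : Fin 3) :
    Linked col i (VV col i) := by
  apply linked_of_common hs
  intro x hx y hy F
  exact ev_exists_notMem hyperfilter_le_cofinite (Eventually.and hx hy) F

/-- Two linked sets covering almost everything give a good one. -/
lemma good_of_cover {col : ℕ → ℕ → Fin 3} {i j : Fin 3} {S T : Set ℕ}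
    (h : (S ∪ T)ᶜ.Finite) : Good col i S ∨ Good col j T := by
  classical
  by_contra hcon
  rw [not_or] at hcon
  obtain ⟨h1, h2⟩ := hcon
  simp only [Good, not_forall, not_exists, not_and, not_le] at h1 h2
  obtain ⟨F, D, N, hD, h1⟩ := h1
  obtain ⟨F', D', N', hD', h2⟩ := h2
  set G := h.toFinset ∪ F ∪ F' with hG
  set Z := 2 * D * D' * (G.card + 1) with hZ
  set n := N + N' + 2 * D * D' * (G.card + 1) with hn
  have key : ∀ (i : Fin 3) (S : Set ℕ) (F : Finset ℕ), F ⊆ G →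
      Adm col i S F (((Finset.range n).filter (fun x => x ∈ S ∧ x ∉ G)).toList) := by
    intro i S F hF
    have hm : ∀ x ∈ ((Finset.range n).filter (fun x => x ∈ S ∧ x ∉ G)).toList, x ∈ S ∧ x ∉ G := by
      intro x hx
      rw [Finset.mem_toList, Finset.mem_filter] at hx
      exact hx.2
    refine ⟨Finset.nodup_toList _, fun x hx hx' => (hm x hx).2 (hF hx'), ?_, ?_, ?_⟩
    · apply List.Pairwise.isChain
      apply List.pairwise_of_forall_mem_list
      intro a ha b hb
      exact Or.inl ⟨(hm a ha).1, (hm b hb).1⟩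
    · intro x hx
      exact (hm x (List.mem_of_mem_head? hx)).1
    · intro x hx
      exact (hm x (List.mem_of_mem_getLast? hx)).1
  have a1 := h1 n (by omega) _ (key i S F (by intro x; simp [hG]; tauto))
  have a2 := h2 n (by omega) _ (key j T F' (by intro x; simp [hG]; tauto))
  have e1 : ∀ S : Set ℕ, (((Finset.range n).filter (fun x => x ∈ S ∧ x ∉ G)).toList.toFinset.filter
      (· < n)) = ((Finset.range n).filter (fun x => x ∈ S ∧ x ∉ G)) := by
    intro S; ext x; simp; tauto
  rw [e1] at a1 a2
  have hc : Finset.range n ⊆ (((Finset.range n).filter (fun x => x ∈ S ∧ x ∉ G)) ∪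
      ((Finset.range n).filter (fun x => x ∈ T ∧ x ∉ G))) ∪ G := by
    intro x hx
    by_cases hxG : x ∈ G
    · simp [hxG]
    · have : x ∈ S ∪ T := by
        by_contra hcon
        apply hxG
        simp only [hG, Finset.mem_union, Set.Finite.mem_toFinset]
        exact Or.inl (Or.inl hcon)
      simp only [Finset.mem_union, Finset.mem_filter]
      rcases this with h | h
      · left; left; exact ⟨hx, h, hxG⟩
      · left; right; exact ⟨hx, h, hxG⟩
  have hc2 := (Finset.card_le_card hc).trans (Finset.card_union_le _ _)
  have hc3 := Finset.card_union_le (((Finset.range n).filter (fun x => x ∈ S ∧ x ∉ G)))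
    ((Finset.range n).filter (fun x => x ∈ T ∧ x ∉ G))
  rw [Finset.card_range] at hc2
  have d1 : G.card + 1 ≤ n / D := by
    rw [Nat.le_div_iff_mul_le (by omega)]
    have : (G.card + 1) * D ≤ (G.card+1) * D * (2 * D') := Nat.le_mul_of_pos_right _ (by omega)
    nlinarith
  have d2 : G.card + 1 ≤ n / D' := by
    rw [Nat.le_div_iff_mul_le (by omega)]
    have : (G.card + 1) * D' ≤ (G.card+1) * D' * (2 * D) := Nat.le_mul_of_pos_right _ (by omega)
    nlinarith
  omega

end MP

namespace MP

lemma simple_path {col : ℕ → ℕ → Fin 3} (hs : ∀ a b, col a b = col b a) {i : Fin 3}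
    {F : Finset ℕ} {x y : ℕ} (h : Relation.ReflTransGen (Step col i F) x y) :
    ∃ r : List ℕ, (y :: r).IsChain (fun a b => col a b = i) ∧ (y :: r).Nodup ∧
      (y :: r).getLast? = some x ∧ ∀ z ∈ y :: r, z = x ∨ z ∉ F := by
  induction h with
  | refl => exact ⟨[], by simp, by simp, by simp, by simp⟩
  | @tail b c _ hbc ih =>
    obtain ⟨r, h1, h2, h3, h4⟩ := ih
    by_cases hc : c ∈ b :: r
    · obtain ⟨s, t, hst⟩ := List.append_of_mem hc
      rw [hst] at h1 h2 h3 h4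
      refine ⟨t, h1.right_of_append, h2.of_append_right, ?_, ?_⟩
      · simpa [List.getLast?_append] using h3
      · intro z hz
        exact h4 z (List.mem_append_right _ hz)
    · refine ⟨b :: r, ?_, ?_, ?_, ?_⟩
      · rw [List.isChain_cons_cons]
        exact ⟨by rw [hs]; exact hbc.1, h1⟩
      · exact List.nodup_cons.2 ⟨hc, h2⟩
      · simpa using h3
      · intro z hz
        rcases List.mem_cons.1 hz with rfl | hz
        · exact Or.inr hbc.2
        · exact h4 z hz

lemma convert_list {col : ℕ → ℕ → Fin 3} (hs : ∀ a b, col a b = col b a) {i : Fin 3}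
    {L : Set ℕ} (hL : Linked col i L) (l : List ℕ) : ∀ (x : ℕ) (p : List ℕ),
    (x :: p).Nodup → (x :: p).IsChain (fun a b => col a b = i) → (x :: l).IsChain (RP col i L) →
    l.Nodup → (∀ z ∈ l, z ∉ x :: p) →
    ∃ q, (q ++ x :: p).Nodup ∧ (q ++ x :: p).IsChain (fun a b => col a b = i) ∧
      (∀ z ∈ l, z ∈ q ++ x :: p) ∧ (q ++ x :: p).head? = (x :: l).getLast? := by
  induction l with
  | nil =>
    intro x p h1 h2 h3 h4 h5
    exact ⟨[], by simpa using h1, by simpa using h2, by simp, by simp⟩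
  | cons y l ih =>
    intro x p h1 h2 h3 h4 h5
    rw [List.isChain_cons_cons] at h3
    rw [List.nodup_cons] at h4
    have hy : y ∉ x :: p := h5 y (by simp)
    have main : ∃ q, (y :: q ++ x :: p).Nodup ∧
        (y :: q ++ x :: p).IsChain (fun a b => col a b = i) ∧ ∀ z ∈ l, z ∉ y :: q := by
      by_cases hxy : col x y = i
      · refine ⟨[], ?_, ?_, ?_⟩
        · simpa using ⟨by simpa using hy, by simpa using h1⟩
        · simp only [List.cons_append, List.nil_append]
          rw [List.isChain_cons_cons]
          exact ⟨by rw [hs]; exact hxy, h2⟩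
        · intro z hz hz'
          simp only [List.mem_singleton] at hz'
          exact h4.1 (hz' ▸ hz)
      · obtain ⟨hx, hyL⟩ : x ∈ L ∧ y ∈ L := by
          rcases h3.1 with h | h
          · exact h
          · exact absurd h hxy
        have hpath := hL (p ++ l).toFinset x hx y hyL (by
          simp only [List.mem_toFinset, List.mem_append, not_or]
          refine ⟨(List.nodup_cons.1 h1).1, fun h => h5 x (List.mem_cons_of_mem _ h) (by simp)⟩) (by
          simp only [List.mem_toFinset, List.mem_append, not_or]
          exact ⟨fun h => hy (List.mem_cons_of_mem _ h), h4.1⟩)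
        obtain ⟨r, c1, c2, c3, c4⟩ := simple_path hs hpath
        obtain ⟨q, hq⟩ := List.getLast?_eq_some_iff.1 c3
        have hyx : y ≠ x := fun h => hy (by simp [h])
        obtain ⟨q', rfl⟩ : ∃ q', q = y :: q' := by
          cases q with
          | nil => simp at hq; exact absurd hq.1 hyx
          | cons a q' => simp at hq; exact ⟨q', by rw [hq.1]⟩
        rw [hq] at c1 c2 c4
        have hxq : ∀ z ∈ y :: q', z ≠ x := by
          intro z hz
          exact (List.nodup_append.1 c2).2.2 z hz x (by simp)
        have hq4 : ∀ z ∈ y :: q', z ∉ p ∧ z ∉ l := by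
          intro z hz
          have := (c4 z (List.mem_append_left _ hz)).resolve_left (hxq z hz)
          simpa using this
        refine ⟨q', ?_, ?_, ?_⟩
        · rw [List.nodup_append]
          refine ⟨c2.of_append_left, h1, ?_⟩
          intro a ha b hb
          rcases List.mem_cons.1 hb with rfl | hb
          · exact hxq a ha
          · intro h
            exact (hq4 a ha).1 (h ▸ hb)
        · exact List.isChain_split.2 ⟨c1, h2⟩
        · intro z hz hz'
          exact (hq4 z hz').2 hz
    obtain ⟨q, e1, e2, e3⟩ := main
    obtain ⟨q', f1, f2, f3, f4⟩ := ih y (q ++ x :: p) e1 e2 h3.2 h4.2 (by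
      intro z hz hz'
      have : z ∈ y :: q ∨ z ∈ x :: p := by
        simp only [List.mem_cons, List.mem_append] at hz' ⊢; tauto
      rcases this with h | h
      · exact e3 z hz h
      · exact h5 z (List.mem_cons_of_mem _ hz) h)
    refine ⟨q' ++ y :: q, ?_, ?_, ?_, ?_⟩
    · simpa using f1
    · simpa using f2
    · intro z hz
      rcases List.mem_cons.1 hz with rfl | hz
      · simp
      · simpa using f3 z hz
    · simpa using f4

/-- The set of states of the infinite path building. -/
structure PState (col : ℕ → ℕ → Fin 3) (i : Fin 3) (L : Set ℕ) (p : List ℕ) : Prop where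
  ne : p ≠ []
  nodup : p.Nodup
  chain : p.IsChain (fun a b => col a b = i)
  hd : ∀ x ∈ p.head?, x ∈ L

lemma pstate_step {col : ℕ → ℕ → Fin 3} (hs : ∀ a b, col a b = col b a) {i : Fin 3}
    {L : Set ℕ} (hL : Linked col i L) (hG : Good col i L) {p : List ℕ} (hp : PState col i L p)
    (k : ℕ) : ∃ p', PState col i L p' ∧ p <:+ p' ∧ p.length < p'.length ∧
      ∃ n, k ≤ n ∧ n ≤ 2 * (p'.toFinset.filter (· < n)).card + n / (k+2) := by
  obtain ⟨n, hn, l, hl, hc⟩ := hG p.toFinset (k+2) (k+1) (by omega)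
  obtain ⟨x, p, rfl⟩ := List.exists_cons_of_ne_nil hp.ne
  cases l with
  | nil =>
    exfalso
    simp at hc
    have := Nat.div_lt_self (n := n) (k := k+2) (by omega) (by omega)
    omega
  | cons y l =>
    have hx : x ∈ L := hp.hd x (by simp)
    have hy : y ∈ L := hl.hd y (by simp)
    obtain ⟨q, h1, h2, h3, h4⟩ := convert_list hs hL (y :: l) x p hp.nodup hp.chain
      (List.isChain_cons_cons.2 ⟨Or.inl ⟨hx, hy⟩, hl.chain⟩) hl.nodup (by
        intro z hz hz'
        exact hl.avoid z hz (by simpa using hz'))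
    refine ⟨q ++ x :: p, ⟨by simp, h1, h2, ?_⟩, List.suffix_append _ _, ?_, n, by omega, ?_⟩
    · intro z hz
      rw [h4] at hz
      apply hl.tl
      simpa using hz
    · have := h3 y (by simp)
      have hyy : y ∉ x :: p := fun h => hl.avoid y (by simp) (by simpa using h)
      have : y ∈ q := by
        rcases List.mem_append.1 this with h | h
        · exact h
        · exact absurd h hyy
      have := List.length_pos_of_mem this
      rw [List.length_append]; omega
    · refine hc.trans ?_
      gcongr
      intro z hz
      rw [List.mem_toFinset] at hz ⊢
      exact h3 z hz

lemma infinite_path {col : ℕ → ℕ → Fin 3} (hs : ∀ a b, col a b = col b a) {i : Fin 3}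
    {L : Set ℕ} (hL : Linked col i L) (hG : Good col i L) :
    ∃ f : ℕ → ℕ, Function.Injective f ∧ (∀ j, col (f j) (f (j+1)) = i) ∧
      ∀ k, ∃ n, k ≤ n ∧ ∃ A : Finset ℕ, (∀ x ∈ A, x < n ∧ x ∈ Set.range f) ∧
        n ≤ 2 * A.card + n / (k+2) := by
  classical
  have hne : ∃ p, PState col i L p := by
    obtain ⟨n, hn, l, hl, hc⟩ := hG ∅ 2 1 (by omega)
    cases l with
    | nil =>
      exfalso
      simp at hc
      omega
    | cons y l =>
      exact ⟨[y], by simp, by simp, by simp, by simpa using hl.hd⟩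
  obtain ⟨p0, hp0⟩ := hne
  let step : ℕ → {p // PState col i L p} → {p // PState col i L p} := fun k p =>
    ⟨(pstate_step hs hL hG p.2 k).choose, (pstate_step hs hL hG p.2 k).choose_spec.1⟩
  have hstep : ∀ k p, p.1 <:+ (step k p).1 ∧ p.1.length < (step k p).1.length ∧
      ∃ n, k ≤ n ∧ n ≤ 2 * ((step k p).1.toFinset.filter (· < n)).card + n / (k+2) :=
    fun k p => (pstate_step hs hL hG p.2 k).choose_spec.2
  let P : ℕ → {p // PState col i L p} := fun n => Nat.rec ⟨p0, hp0⟩ step n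
  have hP : ∀ k, P (k+1) = step k (P k) := fun k => rfl
  have hlen : ∀ k, k < (P k).1.length := by
    intro k
    induction k with
    | zero => exact List.length_pos_iff.2 hp0.ne
    | succ k ih =>
      have := (hstep k (P k)).2.1
      rw [hP]; omega
  have hpre : ∀ a b, a ≤ b → (P a).1.reverse <+: (P b).1.reverse := by
    intro a b hab
    induction hab with
    | refl => exact List.prefix_refl _
    | @step b _ ih =>
      refine ih.trans ?_
      rw [hP, List.reverse_prefix]
      exact (hstep _ _).1
  let f : ℕ → ℕ := fun j => (P j).1.reverse[j]'(by simpa using hlen j)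
  have hf : ∀ k j (h : j < (P k).1.reverse.length), (P k).1.reverse[j] = f j := by
    intro k j h
    have hj : j < (P j).1.reverse.length := by simpa using hlen j
    rcases le_total k j with hkj | hkj
    · exact (hpre k j hkj).getElem h
    · exact ((hpre j k hkj).getElem hj).symm
  refine ⟨f, ?_, ?_, ?_⟩
  · intro a b hab
    have ha : a < (P (a+b)).1.reverse.length := by have := hlen (a+b); simp; omega
    have hb : b < (P (a+b)).1.reverse.length := by have := hlen (a+b); simp; omega
    rw [← hf (a+b) a ha, ← hf (a+b) b hb] at hab
    exact (List.Nodup.getElem_inj_iff (List.nodup_reverse.2 (P (a+b)).2.nodup)).1 hab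
  · intro j
    have hj : j + 1 < (P (j+1)).1.reverse.length := by simpa using hlen (j+1)
    rw [← hf (j+1) j (by omega), ← hf (j+1) (j+1) hj]
    have : (P (j+1)).1.reverse.IsChain (fun a b => col a b = i) := by
      rw [List.isChain_reverse]
      refine (P (j+1)).2.chain.imp ?_
      intro a b h
      rw [hs]; exact h
    exact (List.isChain_iff_getElem.1 this) j hj
  · intro k
    obtain ⟨n, hn, hc⟩ := (hstep k (P k)).2.2
    refine ⟨n, hn, _, ?_, hc⟩
    intro x hx
    rw [Finset.mem_filter, List.mem_toFinset] at hx
    refine ⟨hx.2, ?_⟩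
    have hx' : x ∈ (P (k+1)).1.reverse := by rw [hP]; simpa using hx.1
    obtain ⟨j, hj, rfl⟩ := List.getElem_of_mem hx'
    exact ⟨j, (hf (k+1) j hj).symm⟩

end MP

namespace MP

lemma fin3 {i j k : Fin 3} (hij : i ≠ j) (hik : i ≠ k) (hjk : j ≠ k) (a : Fin 3) :
    a = i ∨ a = j ∨ a = k := by omega

/-- No two linked sets cover almost everything. -/
def NC (col : ℕ → ℕ → Fin 3) : Prop :=
  ∀ i j S T, Linked col i S → Linked col j T → ¬ (S ∪ T)ᶜ.Finite

lemma ev_gt {U : Ultrafilter ℕ} (hU : (U : Filter ℕ) ≤ cofinite) (M : ℕ) :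
    ∀ᶠ t in (U : Filter ℕ), M < t := by
  have : ∀ᶠ t in (U : Filter ℕ), t ∉ Set.Iic M :=
    hU (Set.finite_Iic M).eventually_cofinite_notMem
  filter_upwards [this] with t ht
  simpa using ht

lemma ev_col {col : ℕ → ℕ → Fin 3} {i j k : Fin 3} (hij : i ≠ j) (hik : i ≠ k) (hjk : j ≠ k)
    {V : Set ℕ} {E : ℕ → Finset ℕ} (hE : ∀ t, ∀ x ∈ E t, x ∈ V ∧ t ≤ x) {u : ℕ}
    (hfin : ¬ {w | w ∈ V ∧ col u w = j}.Infinite)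
    (hk : ∀ᶠ t in hyperfilter ℕ, ∀ x ∈ E t, col u x ≠ k) :
    ∀ᶠ t in hyperfilter ℕ, ∀ x ∈ E t, col u x = i := by
  rw [Set.not_infinite] at hfin
  obtain ⟨M, hM⟩ := hfin.bddAbove
  filter_upwards [hk, ev_gt hyperfilter_le_cofinite M] with t h1 h2 x hx
  rcases fin3 hij hik hjk (col u x) with h | h | h
  · exact h
  · have h3 : x ≤ M := hM ⟨(hE t x hx).1, h⟩
    have := (hE t x hx).2
    omega
  · exact absurd h (h1 x hx)

lemma linked_W {col : ℕ → ℕ → Fin 3} (hs : ∀ a b, col a b = col b a) {i : Fin 3}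
    {E : ℕ → Finset ℕ} (hne : ∀ t, (E t).Nonempty) (hE : ∀ t, ∀ x ∈ E t, t ≤ x) {W : Set ℕ}
    (hW : ∀ u ∈ W, ∀ᶠ t in hyperfilter ℕ, ∀ x ∈ E t, col u x = i) : Linked col i W := by
  apply linked_of_common hs
  intro x hx y hy F
  obtain ⟨M, hM⟩ := F.finite_toSet.bddAbove
  obtain ⟨t, h1, h2, h3⟩ := ((hW x hx).and ((hW y hy).and
    (ev_gt hyperfilter_le_cofinite M))).exists
  obtain ⟨w, hw⟩ := hne t
  refine ⟨w, ?_, h1 w hw, h2 w hw⟩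
  intro hwF
  have : w ≤ M := hM (by exact_mod_cast hwF)
  have := hE t w hw
  omega

set_option maxHeartbeats 2000000 in
lemma link_lemma {col : ℕ → ℕ → Fin 3} (hs : ∀ a b, col a b = col b a) (hNC : NC col)
    {i j k : Fin 3} (hij : i ≠ j) (hik : i ≠ k) (hjk : j ≠ k) (F : Finset ℕ) (c : ℕ) :
    ∃ N0, ∀ E1 E2 : Finset ℕ, E1.Nonempty → E2.Nonempty → (∀ x ∈ E1, x ∈ VV col i ∧ N0 ≤ x) →
      (∀ x ∈ E2, x ∈ VV col j ∧ N0 ≤ x) → ∀ B : Finset ℕ, B.card ≤ c →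
      ∃ x ∈ E1 ∪ E2, ∃ v ∈ VV col k, v < N0 ∧ v ∉ F ∧ v ∉ B ∧
        (col v x = k ∨ ∃ u, u < N0 ∧ u ∉ F ∧ u ∉ B ∧ u ≠ v ∧ col v u = k ∧ col u x = k) := by
  by_contra hcon
  push Not at hcon
  choose E1 E2 hn1 hn2 hE1 hE2 B hB hno using hcon
  set Lam : Set ℕ := {u | ∀ᶠ t in hyperfilter ℕ, ∃ x ∈ E1 t ∪ E2 t, col u x = k} with hLam
  set Li : Set ℕ := VV col i ∪ {u | {w | w ∈ VV col i ∧ col u w = i}.Infinite} with hLi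
  set Lj : Set ℕ := VV col j ∪ {u | {w | w ∈ VV col j ∧ col u w = j}.Infinite} with hLj
  have lLi : Linked col i Li := linked_union_of_infinite hs (VV_linked hs i) (fun t ht => ht)
  have lLj : Linked col j Lj := linked_union_of_infinite hs (VV_linked hs j) (fun t ht => ht)
  have hnotLam : ∀ u, u ∉ Lam → ∀ᶠ t in hyperfilter ℕ, ∀ x ∈ E1 t ∪ E2 t, col u x ≠ k := by
    intro u hu
    have := Ultrafilter.eventually_not.2 hu
    filter_upwards [this] with t ht x hx hx'
    exact ht ⟨x, hx, hx'⟩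
  have lWi : Linked col i (Lj ∪ Lam)ᶜ := by
    apply linked_W hs hn2 (fun t x hx => (hE2 t x hx).2)
    intro u hu
    simp only [Set.mem_compl_iff, Set.mem_union, not_or] at hu
    apply ev_col hij hik hjk hE2 (fun h => hu.1 (Or.inr h))
    filter_upwards [hnotLam u hu.2] with t ht x hx
    exact ht x (Finset.mem_union_right _ hx)
  have lWj : Linked col j (Li ∪ Lam)ᶜ := by
    apply linked_W hs hn1 (fun t x hx => (hE1 t x hx).2)
    intro u hu
    simp only [Set.mem_compl_iff, Set.mem_union, not_or] at hu
    apply ev_col hij.symm hjk hik hE1 (fun h => hu.1 (Or.inr h))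
    filter_upwards [hnotLam u hu.2] with t ht x hx
    exact ht x (Finset.mem_union_left _ hx)
  set Th : Set ℕ := (Li ∪ Lj ∪ Lam)ᶜ with hTh
  have lThi : Linked col i Th := lWi.mono (by intro x; simp [hTh]; tauto)
  have lThj : Linked col j Th := lWj.mono (by intro x; simp [hTh]; tauto)
  have hThV : Th ⊆ VV col k := by
    intro x hx
    simp only [hTh, Set.mem_compl_iff, Set.mem_union, not_or] at hx
    obtain ⟨a, ha⟩ := VV_exists col x
    rcases fin3 hij hik hjk a with rfl | rfl | rfl
    · exact absurd (Or.inl ha) hx.1.1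
    · exact absurd (Or.inl ha) hx.1.2
    · exact ha
  -- a general pigeonhole: an infinite set has c+1 elements outside F
  have pig : ∀ (S : Set ℕ) (G : Finset ℕ), S.Infinite → ∃ A : Finset ℕ, A.card = c + 1 ∧
      (∀ a ∈ A, a ∈ S ∧ a ∉ G) := by
    intro S G hS
    obtain ⟨A, hA, hAc⟩ := (hS.sdiff G.finite_toSet).exists_subset_card_eq (c+1)
    refine ⟨A, hAc, fun a ha => ?_⟩
    have := hA ha
    exact ⟨this.1, by simpa using this.2⟩
  -- Λ ∩ V_k is finite
  have f1 : (Lam ∩ VV col k).Finite := by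
    by_contra hinf
    obtain ⟨A, hAc, hA⟩ := pig _ F hinf
    have e1 : ∀ᶠ t in hyperfilter ℕ, ∀ a ∈ A, ∃ x ∈ E1 t ∪ E2 t, col a x = k :=
      (Finset.eventually_all A).2 (fun a ha => (hA a ha).1.1)
    have e2 : ∀ᶠ t in hyperfilter ℕ, ∀ a ∈ A, a < t :=
      (Finset.eventually_all A).2 (fun a _ => ev_gt hyperfilter_le_cofinite a)
    obtain ⟨t, h1, h2⟩ := (e1.and e2).exists
    obtain ⟨a, ha, haB⟩ := Finset.exists_mem_notMem_of_card_lt_card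
      (s := B t) (t := A) (by have := hB t; omega)
    obtain ⟨x, hx, hxa⟩ := h1 a ha
    exact (hno t x hx a (hA a ha).1.2 (h2 a ha) (hA a ha).2 haB).1 hxa
  have cov : (Li ∪ Lj ∪ Th)ᶜ.Finite := by
    apply f1.subset
    intro x hx
    simp only [hTh, Set.mem_compl_iff, Set.mem_union, not_or, not_not] at hx
    refine ⟨by tauto, ?_⟩
    obtain ⟨a, ha⟩ := VV_exists col x
    rcases fin3 hij hik hjk a with rfl | rfl | rfl
    · exact absurd (Or.inl ha) hx.1.1
    · exact absurd (Or.inl ha) hx.1.2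
    · exact ha
  have hThinf : Th.Infinite := by
    intro hfin
    apply hNC i j Li Lj lLi lLj
    apply (cov.union hfin).subset
    intro x hx
    by_cases h : x ∈ Th
    · exact Or.inr h
    · left; simp only [Set.mem_compl_iff, Set.mem_union] at hx ⊢; tauto
  haveI := hThinf.cofinite_inf_principal_neBot
  set U3 : Ultrafilter ℕ := Ultrafilter.of (cofinite ⊓ 𝓟 Th) with hU3
  have hU3c : (U3 : Filter ℕ) ≤ cofinite := (Ultrafilter.of_le _).trans inf_le_left
  have hU3T : ∀ᶠ w in (U3 : Filter ℕ), w ∈ Th :=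
    le_principal_iff.1 ((Ultrafilter.of_le (cofinite ⊓ 𝓟 Th)).trans inf_le_right)
  set P : Fin 3 → Set ℕ := fun a => {u | ∀ᶠ w in (U3 : Filter ℕ), col u w = a} with hP
  have hPinf : ∀ a, ∀ u ∈ P a, {w | w ∈ Th ∧ col u w = a}.Infinite := by
    intro a u hu hfin
    have h1 : ∀ᶠ w in (U3 : Filter ℕ), w ∉ {w | w ∈ Th ∧ col u w = a} :=
      hU3c hfin.eventually_cofinite_notMem
    obtain ⟨w, h1, h2, h3⟩ := (h1.and (hU3T.and hu)).exists
    exact h1 ⟨h2, h3⟩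
  have lPi : Linked col i (Th ∪ P i) := linked_union_of_infinite hs lThi (hPinf i)
  have lPj : Linked col j (Th ∪ P j) := linked_union_of_infinite hs lThj (hPinf j)
  have f2 : (Lam ∩ P k).Finite := by
    by_contra hinf
    obtain ⟨A, hAc, hA⟩ := pig _ F hinf
    have e3 : ∀ᶠ w in (U3 : Filter ℕ), ∀ a ∈ A, col a w = k :=
      (Finset.eventually_all A).2 (fun a ha => (hA a ha).1.2)
    have hTinf : {w | w ∈ Th ∧ ∀ a ∈ A, col a w = k}.Infinite := by
      intro hfin
      have h1 : ∀ᶠ w in (U3 : Filter ℕ), w ∉ {w | w ∈ Th ∧ ∀ a ∈ A, col a w = k} :=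
        hU3c hfin.eventually_cofinite_notMem
      obtain ⟨w, h1, h2, h3⟩ := (h1.and (hU3T.and e3)).exists
      exact h1 ⟨h2, h3⟩
    obtain ⟨T, hTc, hT⟩ := pig _ (F ∪ A) hTinf
    have e1 : ∀ᶠ t in hyperfilter ℕ, ∀ a ∈ A, ∃ x ∈ E1 t ∪ E2 t, col a x = k :=
      (Finset.eventually_all A).2 (fun a ha => (hA a ha).1.1)
    have e2 : ∀ᶠ t in hyperfilter ℕ, ∀ a ∈ A ∪ T, a < t :=
      (Finset.eventually_all _).2 (fun a _ => ev_gt hyperfilter_le_cofinite a)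
    obtain ⟨t, h1, h2⟩ := (e1.and e2).exists
    obtain ⟨a, ha, haB⟩ := Finset.exists_mem_notMem_of_card_lt_card
      (s := B t) (t := A) (by have := hB t; omega)
    obtain ⟨v, hv, hvB⟩ := Finset.exists_mem_notMem_of_card_lt_card
      (s := B t) (t := T) (by have := hB t; omega)
    obtain ⟨x, hx, hxa⟩ := h1 a ha
    have hvF : v ∉ F ∧ v ∉ A := by simpa using (hT v hv).2
    refine (hno t x hx v (hThV (hT v hv).1.1) (h2 v (Finset.mem_union_right _ hv)) hvF.1 hvB).2
      a (h2 a (Finset.mem_union_left _ ha)) (hA a ha).2 haB ?_ ?_ hxa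
    · rintro rfl; exact hvF.2 ha
    · rw [hs]; exact (hT v hv).1.2 a ha
  have f3 : (Li ∩ P i).Finite := by
    by_contra hinf
    have h1 : Linked col i (Li ∪ (Th ∪ P i)) := by
      apply linked_union lLi lPi
      apply Set.Infinite.mono _ hinf
      intro x hx; exact ⟨hx.1, Or.inr hx.2⟩
    apply hNC i j _ _ h1 lLj
    apply cov.subset
    intro x hx
    simp only [Set.mem_compl_iff, Set.mem_union] at hx ⊢; tauto
  have f4 : (Li ∩ (Lj ∪ Lam)ᶜ).Finite := by
    by_contra hinf
    have h1 : Linked col i (Li ∪ (Lj ∪ Lam)ᶜ) := linked_union lLi lWi hinf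
    apply hNC i j _ _ h1 lLj
    apply cov.subset
    intro x hx
    simp only [hTh, Set.mem_compl_iff, Set.mem_union] at hx ⊢; tauto
  apply hNC j j _ _ lPj lLj
  apply (((cov.union f2).union f3).union f4).subset
  intro x hx
  have hPx : x ∈ P i ∨ x ∈ P j ∨ x ∈ P k := by
    obtain ⟨a, ha⟩ := ultra_fin U3 (fun w => col x w)
    rcases fin3 hij hik hjk a with rfl | rfl | rfl
    · exact Or.inl ha
    · exact Or.inr (Or.inl ha)
    · exact Or.inr (Or.inr ha)
  have hxT : x ∉ Th := fun h => hx (Or.inl (Or.inl h))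
  have hxj : x ∉ P j := fun h => hx (Or.inl (Or.inr h))
  have hxL : x ∉ Lj := fun h => hx (Or.inr h)
  by_cases h1 : x ∈ Li
  · by_cases h2 : x ∈ Lam
    · rcases hPx with h | h | h
      · exact Or.inl (Or.inr ⟨h1, h⟩)
      · exact absurd h hxj
      · exact Or.inl (Or.inl (Or.inr ⟨h2, h⟩))
    · refine Or.inr ⟨h1, ?_⟩
      rintro (h | h)
      · exact hxL h
      · exact h2 h
  · refine Or.inl (Or.inl (Or.inl ?_))
    rintro ((h | h) | h)
    · exact h1 h
    · exact hxL h
    · exact hxT h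

end MP

namespace MP

lemma forest_aux {col : ℕ → ℕ → Fin 3} (hs : ∀ a b, col a b = col b a) (i : Fin 3)
    (V : Set ℕ) : ∀ (m : ℕ) (S R : Finset ℕ), S.card = m → (∀ s ∈ S, s ∈ V) → Disjoint S R →
    ∀ s0 ∈ S, ∃ (l : List ℕ) (O : Finset ℕ), O ⊆ S ∧ l.head? = some s0 ∧ l.Nodup ∧
      (∀ x ∈ l, x ∈ S ∪ R) ∧ (∀ x ∈ S, x ∈ l) ∧ (∀ x ∈ l.getLast?, x ∈ S) ∧
      l.IsChain (RP col i V) ∧ O.card = (l.toFinset ∩ R).card ∧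
      ∀ q ∈ R, q ∉ l → ((S \ O).filter (fun s => col s q = i)).card ≤ 1 := by
  intro m
  induction m with
  | zero =>
    intro S R hS _ _ s0 hs0
    rw [Finset.card_eq_zero] at hS
    simp [hS] at hs0
  | succ m ih =>
    intro S R hS hV hd s0 hs0
    have hS' : (S.erase s0).card = m := by rw [Finset.card_erase_of_mem hs0, hS]; rfl
    have hV' : ∀ s ∈ S.erase s0, s ∈ V := fun s h => hV s (Finset.mem_of_mem_erase h)
    have hs0R : s0 ∉ R := Finset.disjoint_left.1 hd hs0
    by_cases hne : (S.erase s0).Nonempty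
    · by_cases hex : ∃ r ∈ R, col s0 r = i ∧ ∃ s' ∈ S.erase s0, col s' r = i
      · obtain ⟨r, hr, hr0, s', hs', hr'⟩ := hex
        have hrS : r ∉ S := Finset.disjoint_right.1 hd hr
        obtain ⟨l, O, h1, h2, h3, h4, h5, h6, h7, h8, h9⟩ := ih (S.erase s0) (R.erase r) hS' hV'
          (Finset.disjoint_of_subset_left (Finset.erase_subset _ _)
            (Finset.disjoint_of_subset_right (Finset.erase_subset _ _) hd)) s' hs'
        have hrl : r ∉ l := by
          intro h
          have := h4 r h
          simp only [Finset.mem_union, Finset.mem_erase] at this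
          tauto
        have hs0l : s0 ∉ l := by
          intro h
          have := h4 s0 h
          simp only [Finset.mem_union, Finset.mem_erase] at this
          tauto
        have hne0 : s0 ≠ r := fun h => hs0R (h ▸ hr)
        have hlne : l ≠ [] := by rintro rfl; simp at h2
        refine ⟨s0 :: r :: l, insert s0 O, ?_, by simp, ?_, ?_, ?_, ?_, ?_, ?_, ?_⟩
        · intro x hx
          rcases Finset.mem_insert.1 hx with rfl | hx
          · exact hs0
          · exact Finset.mem_of_mem_erase (h1 hx)
        · simp only [List.nodup_cons, List.mem_cons, not_or]
          exact ⟨⟨hne0, hs0l⟩, hrl, h3⟩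
        · intro x hx
          simp only [List.mem_cons] at hx
          rcases hx with rfl | rfl | hx
          · exact Finset.mem_union_left _ hs0
          · exact Finset.mem_union_right _ hr
          · have := h4 x hx
            simp only [Finset.mem_union, Finset.mem_erase] at this ⊢
            tauto
        · intro x hx
          by_cases hx0 : x = s0
          · simp [hx0]
          · have := h5 x (Finset.mem_erase.2 ⟨hx0, hx⟩)
            simp [this]
        · intro x hx
          rw [List.getLast?_cons_cons, List.getLast?_cons_of_ne_nil hlne] at hx
          exact Finset.mem_of_mem_erase (h6 x hx)
        · rw [List.isChain_cons_cons, List.isChain_cons]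
          refine ⟨Or.inr hr0, ?_, h7⟩
          intro y hy
          rw [h2] at hy
          simp only [Option.mem_some_iff] at hy
          subst hy
          right; rw [hs]; exact hr'
        · rw [Finset.card_insert_of_notMem (fun h => by simpa using h1 h), h8]
          have : (s0 :: r :: l).toFinset ∩ R = insert r (l.toFinset ∩ R.erase r) := by
            ext x
            simp only [Finset.mem_inter, List.mem_toFinset, List.mem_cons, Finset.mem_insert,
              Finset.mem_erase]
            constructor
            · rintro ⟨rfl | rfl | h, hR⟩
              · exact absurd hR hs0R
              · exact Or.inl rfl
              · right; exact ⟨h, fun he => hrl (he ▸ h), hR⟩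
            · rintro (rfl | h)
              · exact ⟨Or.inr (Or.inl rfl), hr⟩
              · exact ⟨Or.inr (Or.inr h.1), h.2.2⟩
          rw [this, Finset.card_insert_of_notMem (by simp)]
        · intro q hq hql
          simp only [List.mem_cons, not_or] at hql
          have := h9 q (Finset.mem_erase.2 ⟨hql.2.1, hq⟩) hql.2.2
          have he : S \ insert s0 O = S.erase s0 \ O := by
            ext x; simp only [Finset.mem_sdiff, Finset.mem_insert, Finset.mem_erase]; tauto
          rw [he]; exact this
      · push Not at hex
        obtain ⟨s', hs'⟩ := hne
        obtain ⟨l, O, h1, h2, h3, h4, h5, h6, h7, h8, h9⟩ := ih (S.erase s0) R hS' hV'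
          (Finset.disjoint_of_subset_left (Finset.erase_subset _ _) hd) s' hs'
        have hs0l : s0 ∉ l := by
          intro h
          have := h4 s0 h
          simp only [Finset.mem_union, Finset.mem_erase] at this
          tauto
        have hlne : l ≠ [] := by rintro rfl; simp at h2
        refine ⟨s0 :: l, O, h1.trans (Finset.erase_subset _ _), by simp, ?_, ?_, ?_, ?_, ?_, ?_, ?_⟩
        · simp only [List.nodup_cons]
          exact ⟨hs0l, h3⟩
        · intro x hx
          simp only [List.mem_cons] at hx
          rcases hx with rfl | hx
          · exact Finset.mem_union_left _ hs0
          · have := h4 x hx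
            simp only [Finset.mem_union, Finset.mem_erase] at this ⊢
            tauto
        · intro x hx
          by_cases hx0 : x = s0
          · simp [hx0]
          · have := h5 x (Finset.mem_erase.2 ⟨hx0, hx⟩)
            simp [this]
        · intro x hx
          rw [List.getLast?_cons_of_ne_nil hlne] at hx
          exact Finset.mem_of_mem_erase (h6 x hx)
        · rw [List.isChain_cons]
          refine ⟨?_, h7⟩
          intro y hy
          rw [h2] at hy
          simp only [Option.mem_some_iff] at hy
          subst hy
          left; exact ⟨hV _ hs0, hV' _ hs'⟩
        · rw [h8]
          congr 1
          ext x
          simp only [Finset.mem_inter, List.mem_toFinset, List.mem_cons]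
          constructor
          · rintro ⟨h, hR⟩; exact ⟨Or.inr h, hR⟩
          · rintro ⟨rfl | h, hR⟩
            · exact absurd hR hs0R
            · exact ⟨h, hR⟩
        · intro q hq hql
          simp only [List.mem_cons, not_or] at hql
          have h10 := h9 q hq hql.2
          by_cases hq0 : col s0 q = i
          · apply Finset.card_le_one.2
            have : ∀ a ∈ (S \ O).filter (fun s => col s q = i), a = s0 := by
              intro a ha
              simp only [Finset.mem_filter, Finset.mem_sdiff] at ha
              by_contra hne
              exact hex q hq hq0 a (Finset.mem_erase.2 ⟨hne, ha.1.1⟩) ha.2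
            intro a ha b hb
            rw [this a ha, this b hb]
          · refine le_trans (Finset.card_le_card ?_) h10
            intro a ha
            simp only [Finset.mem_filter, Finset.mem_sdiff, Finset.mem_erase] at ha ⊢
            refine ⟨⟨⟨?_, ha.1.1⟩, ha.1.2⟩, ha.2⟩
            rintro rfl; exact hq0 ha.2
    · have hS0 : S = {s0} := by
        rw [Finset.not_nonempty_iff_eq_empty, Finset.erase_eq_empty_iff] at hne
        rcases hne with h | h
        · simp [h] at hs0
        · exact h
      subst hS0
      refine ⟨[s0], ∅, by simp, by simp, by simp, by simp, by simp, by simp, by simp, ?_, ?_⟩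
      · simp [hs0R]
      · intro q _ _
        refine (Finset.card_le_card (Finset.filter_subset _ _)).trans ?_
        simp

lemma forest {col : ℕ → ℕ → Fin 3} (hs : ∀ a b, col a b = col b a) (i : Fin 3)
    (V : Set ℕ) (S R : Finset ℕ) (hV : ∀ s ∈ S, s ∈ V) (hd : Disjoint S R) :
    ∃ (l : List ℕ) (O : Finset ℕ), O ⊆ S ∧ (∀ x ∈ l.head?, x ∈ S) ∧ l.Nodup ∧
      (∀ x ∈ l, x ∈ S ∪ R) ∧ (∀ x ∈ S, x ∈ l) ∧ (∀ x ∈ l.getLast?, x ∈ S) ∧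
      l.IsChain (RP col i V) ∧ O.card = (l.toFinset ∩ R).card ∧
      ∀ q ∈ R, q ∉ l → ((S \ O).filter (fun s => col s q = i)).card ≤ 1 := by
  rcases S.eq_empty_or_nonempty with rfl | ⟨s0, hs0⟩
  · exact ⟨[], ∅, by simp⟩
  · obtain ⟨l, O, h1, h2, h⟩ := forest_aux hs i V _ S R rfl hV hd s0 hs0
    refine ⟨l, O, h1, ?_, h⟩
    intro x hx
    rw [h2] at hx
    simp only [Option.mem_some_iff] at hx
    exact hx ▸ hs0

end MP

namespace MP

lemma pick1 (X Y Z : Finset ℕ) (z : ℕ) (hY : Y.card ≤ 5) (hZ : Z.card ≤ 5) (h : 20 ≤ X.card) :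
    ∃ x ∈ X, x ∉ Y ∧ x ∉ Z ∧ x ≠ z := by
  have h1 := Finset.card_union_le Y Z
  have h2 := Finset.card_insert_le z (Y ∪ Z)
  obtain ⟨x, hx, hx'⟩ := Finset.exists_mem_notMem_of_card_lt_card
    (s := insert z (Y ∪ Z)) (t := X) (by omega)
  simp only [Finset.mem_insert, Finset.mem_union, not_or] at hx'
  exact ⟨x, hx, hx'.2.1, hx'.2.2, hx'.1⟩

lemma path_aux {col : ℕ → ℕ → Fin 3} (hs : ∀ a b, col a b = col b a) (k : Fin 3) :
    ∀ (L : ℕ) (A B : Finset ℕ), Disjoint A B →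
    (∀ a ∈ A, (B.filter (fun b => col a b ≠ k)).card ≤ 5) →
    (∀ b ∈ B, (A.filter (fun a => col b a ≠ k)).card ≤ 5) →
    L + 20 ≤ A.card → L + 20 ≤ B.card → ∀ x ∈ A, ∀ x' ∈ A ∪ B, x ≠ x' →
    ∃ l : List ℕ, l.Nodup ∧ (∀ z ∈ l, z ∈ A ∪ B) ∧ l.IsChain (fun a b => col a b = k) ∧
      l.head? = some x ∧ l.getLast? = some x' ∧ L ≤ l.length := by
  intro L
  induction L with
  | zero =>
    intro A B hd hA hB cA cB x hx x' hx' hne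
    have hxB : x ∉ B := Finset.disjoint_left.1 hd hx
    rcases Finset.mem_union.1 hx' with hx' | hx'
    · have hxB' : x' ∉ B := Finset.disjoint_left.1 hd hx'
      obtain ⟨b, hb, h1, h2, h3⟩ := pick1 B _ _ x (hA x hx) (hA x' hx') (by omega)
      simp only [Finset.mem_filter, hb, true_and, not_not] at h1 h2
      refine ⟨[x, b, x'], ?_, ?_, ?_, by simp, by simp, by simp⟩
      · have : b ≠ x' := fun h => hxB' (h ▸ hb)
        simp; tauto
      · simp only [List.mem_cons, List.not_mem_nil, or_false, Finset.mem_union]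
        rintro z (rfl | rfl | rfl) <;> tauto
      · simp only [List.isChain_cons_cons, List.isChain_singleton, and_true]
        exact ⟨h1, by rw [hs]; exact h2⟩
    · have hxA' : x' ∉ A := Finset.disjoint_right.1 hd hx'
      obtain ⟨b, hb, h1, -, h3⟩ := pick1 B _ ∅ x' (hA x hx) (by simp) (by omega)
      obtain ⟨a, ha, g1, g2, g3⟩ := pick1 A _ _ x (hB b hb) (hB x' hx') (by omega)
      simp only [Finset.mem_filter, hb, true_and, not_not] at h1
      simp only [Finset.mem_filter, ha, true_and, not_not] at g1 g2
      have hbA : b ∉ A := Finset.disjoint_right.1 hd hb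
      refine ⟨[x, b, a, x'], ?_, ?_, ?_, by simp, by simp, by simp⟩
      · have e1 : b ≠ a := fun h => hbA (h ▸ ha)
        have e2 : x ≠ b := fun h => hbA (h ▸ hx)
        have e3 : a ≠ x' := fun h => hxA' (h ▸ ha)
        simp; tauto
      · simp only [List.mem_cons, List.not_mem_nil, or_false, Finset.mem_union]
        rintro z (rfl | rfl | rfl | rfl) <;> tauto
      · simp only [List.isChain_cons_cons, List.isChain_singleton, and_true]
        exact ⟨h1, g1, by rw [hs]; exact g2⟩
  | succ L ih =>
    intro A B hd hA hB cA cB x hx x' hx' hne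
    obtain ⟨y, hy, h1, -, h3⟩ := pick1 B _ ∅ x' (hA x hx) (by simp) (by omega)
    simp only [Finset.mem_filter, hy, true_and, not_not] at h1
    have hxB : x ∉ B := Finset.disjoint_left.1 hd hx
    obtain ⟨l, g1, g2, g3, g4, g5, g6⟩ := ih B (A.erase x)
      (Finset.disjoint_of_subset_right (Finset.erase_subset _ _) hd.symm)
      (fun b hb => (Finset.card_le_card (Finset.filter_subset_filter _
        (Finset.erase_subset _ _))).trans (hB b hb))
      (fun a ha => hA a (Finset.mem_of_mem_erase ha)) (by omega)
      (by rw [Finset.card_erase_of_mem hx]; omega) y hy x' (by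
        simp only [Finset.mem_union, Finset.mem_erase] at hx' ⊢
        rcases hx' with h | h
        · exact Or.inr ⟨hne.symm, h⟩
        · exact Or.inl h) h3
    have hlne : l ≠ [] := by rintro rfl; simp at g4
    refine ⟨x :: l, ?_, ?_, ?_, by simp, ?_, ?_⟩
    · refine List.nodup_cons.2 ⟨fun h => ?_, g1⟩
      have := g2 x h
      simp [hxB] at this
    · intro z hz
      rcases List.mem_cons.1 hz with rfl | hz
      · exact Finset.mem_union_left _ hx
      · have := g2 z hz
        simp only [Finset.mem_union, Finset.mem_erase] at this ⊢
        tauto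
    · rw [List.isChain_cons]
      refine ⟨?_, g3⟩
      intro z hz
      rw [g4] at hz
      simp only [Option.mem_some_iff] at hz
      exact hz ▸ h1
    · rw [List.getLast?_cons_of_ne_nil hlne]; exact g5
    · simp; omega

lemma path_lemma {col : ℕ → ℕ → Fin 3} (hs : ∀ a b, col a b = col b a) (k : Fin 3)
    (L : ℕ) (A B : Finset ℕ) (hd : Disjoint A B)
    (hA : ∀ a ∈ A, (B.filter (fun b => col a b ≠ k)).card ≤ 5)
    (hB : ∀ b ∈ B, (A.filter (fun a => col b a ≠ k)).card ≤ 5)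
    (cA : L + 20 ≤ A.card) (cB : L + 20 ≤ B.card) (x : ℕ) (hx : x ∈ A ∪ B) (x' : ℕ)
    (hx' : x' ∈ A ∪ B) (hne : x ≠ x') :
    ∃ l : List ℕ, l.Nodup ∧ (∀ z ∈ l, z ∈ A ∪ B) ∧ l.IsChain (fun a b => col a b = k) ∧
      l.head? = some x ∧ l.getLast? = some x' ∧ L ≤ l.length := by
  rcases Finset.mem_union.1 hx with h | h
  · exact path_aux hs k L A B hd hA hB cA cB x h x' hx' hne
  · rw [Finset.union_comm] at hx' ⊢
    exact path_aux hs k L B A hd.symm hB hA cB cA x h x' hx' hne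

lemma count_bad (r : ℕ → ℕ → Prop) [DecidableRel r] (X Y : Finset ℕ)
    (h : ∀ y ∈ Y, (X.filter (fun x => r x y)).card ≤ 1) :
    5 * (X.filter (fun x => 5 ≤ (Y.filter (fun y => r x y)).card)).card ≤ Y.card := by
  have h1 := Finset.sum_card_bipartiteAbove_eq_sum_card_bipartiteBelow (s := X) (t := Y) r
  have h2 : ∑ y ∈ Y, (X.bipartiteBelow r y).card ≤ Y.card := by
    have := Finset.sum_le_card_nsmul Y (fun y => (X.bipartiteBelow r y).card) 1 h
    simpa using this
  have h3 : (X.filter (fun x => 5 ≤ (Y.filter (fun y => r x y)).card)).card • 5 ≤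
      ∑ x ∈ X.filter (fun x => 5 ≤ (Y.filter (fun y => r x y)).card), (Y.bipartiteAbove r x).card := by
    apply Finset.card_nsmul_le_sum
    intro x hx
    exact (Finset.mem_filter.1 hx).2
  have h4 : ∑ x ∈ X.filter (fun x => 5 ≤ (Y.filter (fun y => r x y)).card),
      (Y.bipartiteAbove r x).card ≤ ∑ x ∈ X, (Y.bipartiteAbove r x).card :=
    Finset.sum_le_sum_of_subset (Finset.filter_subset _ _)
  rw [smul_eq_mul] at h3
  omega

lemma clean {col : ℕ → ℕ → Fin 3} (hs : ∀ a b, col a b = col b a) {i j k : Fin 3}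
    (hij : i ≠ j) (hik : i ≠ k) (hjk : j ≠ k) (m : ℕ) (E1 E2 : Finset ℕ)
    (h1 : ∀ y ∈ E2, (E1.filter (fun x => col x y = i)).card ≤ 1)
    (h2 : ∀ x ∈ E1, (E2.filter (fun y => col y x = j)).card ≤ 1)
    (c1 : m ≤ E1.card) (c2 : m ≤ E2.card) :
    ∃ A B : Finset ℕ, A ⊆ E1 ∧ B ⊆ E2 ∧ 4 * m ≤ 5 * A.card ∧ 4 * m ≤ 5 * B.card ∧
    (∀ a ∈ A, (B.filter (fun b => col a b ≠ k)).card ≤ 5) ∧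
    (∀ b ∈ B, (A.filter (fun a => col b a ≠ k)).card ≤ 5) := by
  obtain ⟨X, hX, cX⟩ := Finset.exists_subset_card_eq c1
  obtain ⟨Y, hY, cY⟩ := Finset.exists_subset_card_eq c2
  have h1' : ∀ y ∈ Y, (X.filter (fun x => col x y = i)).card ≤ 1 := fun y hy =>
    (Finset.card_le_card (Finset.filter_subset_filter _ hX)).trans (h1 y (hY hy))
  have h2' : ∀ x ∈ X, (Y.filter (fun y => col y x = j)).card ≤ 1 := fun y hy =>
    (Finset.card_le_card (Finset.filter_subset_filter _ hY)).trans (h2 y (hX hy))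
  have b1 := count_bad (fun x y => col x y = i) X Y h1'
  have b2 := count_bad (fun x y => col x y = j) Y X h2'
  have s1 := Finset.card_filter_add_card_filter_not (s := X)
    (fun x => 5 ≤ (Y.filter (fun y => col x y = i)).card)
  have s2 := Finset.card_filter_add_card_filter_not (s := Y)
    (fun x => 5 ≤ (X.filter (fun y => col x y = j)).card)
  have gen : ∀ (p : ℕ → Fin 3) (Y' : Finset ℕ) (i j : Fin 3), i ≠ j → i ≠ k → j ≠ k →
      (Y'.filter (fun y => p y = i)).card ≤ 4 → (Y'.filter (fun y => p y = j)).card ≤ 1 →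
      (Y'.filter (fun y => p y ≠ k)).card ≤ 5 := by
    intro p Y' i j hij hik hjk a1 a2
    have : Y'.filter (fun y => p y ≠ k) ⊆ Y'.filter (fun y => p y = i) ∪
        Y'.filter (fun y => p y = j) := by
      intro y hy
      simp only [Finset.mem_filter, Finset.mem_union] at hy ⊢
      rcases fin3 hij hik hjk (p y) with h | h | h
      · exact Or.inl ⟨hy.1, h⟩
      · exact Or.inr ⟨hy.1, h⟩
      · exact absurd h hy.2
    have := (Finset.card_le_card this).trans (Finset.card_union_le _ _)
    omega
  refine ⟨X.filter (fun x => ¬ 5 ≤ (Y.filter (fun y => col x y = i)).card),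
    Y.filter (fun x => ¬ 5 ≤ (X.filter (fun y => col x y = j)).card),
    (Finset.filter_subset _ _).trans hX, (Finset.filter_subset _ _).trans hY, by omega, by omega,
    ?_, ?_⟩
  · intro a ha
    rw [Finset.mem_filter] at ha
    apply gen (fun b => col a b) _ i j hij hik hjk
    · have := Finset.card_le_card (Finset.filter_subset_filter (fun y => col a y = i)
        (Finset.filter_subset (fun x => ¬ 5 ≤ (X.filter (fun y => col x y = j)).card) Y))
      omega
    · refine le_trans (Finset.card_le_card ?_) (h2' a ha.1)
      intro y hy
      simp only [Finset.mem_filter] at hy ⊢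
      exact ⟨hy.1.1, by rw [hs]; exact hy.2⟩
  · intro b hb
    rw [Finset.mem_filter] at hb
    apply gen (fun a => col b a) _ j i hij.symm hjk hik
    · have := Finset.card_le_card (Finset.filter_subset_filter (fun y => col b y = j)
        (Finset.filter_subset (fun x => ¬ 5 ≤ (Y.filter (fun y => col x y = i)).card) X))
      omega
    · refine le_trans (Finset.card_le_card ?_) (h1' b hb.1)
      intro y hy
      simp only [Finset.mem_filter] at hy ⊢
      exact ⟨hy.1.1, by rw [hs]; exact hy.2⟩

/-- The conclusion of the link lemma for a given threshold. -/
def LinkProp (col : ℕ → ℕ → Fin 3) (i j k : Fin 3) (F : Finset ℕ) (c N0 : ℕ) : Prop :=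
  ∀ E1 E2 : Finset ℕ, E1.Nonempty → E2.Nonempty → (∀ x ∈ E1, x ∈ VV col i ∧ N0 ≤ x) →
      (∀ x ∈ E2, x ∈ VV col j ∧ N0 ≤ x) → ∀ B : Finset ℕ, B.card ≤ c →
      ∃ x ∈ E1 ∪ E2, ∃ w : List ℕ, w ≠ [] ∧ w.length ≤ 2 ∧ w.Nodup ∧
        (∀ z ∈ w, z < N0 ∧ z ∉ F ∧ z ∉ B) ∧ w.IsChain (fun a b => col a b = k) ∧
        (∀ z ∈ w.head?, z ∈ VV col k) ∧ (∀ z ∈ w.getLast?, col z x = k)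

lemma LinkProp.mono {col : ℕ → ℕ → Fin 3} {i j k : Fin 3} {F : Finset ℕ} {c N0 N1 : ℕ}
    (h : LinkProp col i j k F c N0) (hN : N0 ≤ N1) : LinkProp col i j k F c N1 := by
  intro E1 E2 n1 n2 h1 h2 B hB
  obtain ⟨x, hx, w, a1, a2, a3, a4, a5⟩ := h E1 E2 n1 n2 (fun x hx => ⟨(h1 x hx).1, by have := (h1 x hx).2; omega⟩)
    (fun x hx => ⟨(h2 x hx).1, by have := (h2 x hx).2; omega⟩) B hB
  exact ⟨x, hx, w, a1, a2, a3, fun z hz => ⟨by have := (a4 z hz).1; omega, (a4 z hz).2⟩, a5⟩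

lemma exists_linkProp {col : ℕ → ℕ → Fin 3} (hs : ∀ a b, col a b = col b a) (hNC : NC col)
    {i j k : Fin 3} (hij : i ≠ j) (hik : i ≠ k) (hjk : j ≠ k) (F : Finset ℕ) (c : ℕ) :
    ∃ N0, LinkProp col i j k F c N0 := by
  obtain ⟨N0, h⟩ := link_lemma hs hNC hij hik hjk F c
  refine ⟨N0, ?_⟩
  intro E1 E2 n1 n2 h1 h2 B hB
  obtain ⟨x, hx, v, hv, hvN, hvF, hvB, hlink⟩ := h E1 E2 n1 n2 h1 h2 B hB
  refine ⟨x, hx, ?_⟩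
  rcases hlink with hvx | ⟨u, huN, huF, huB, huv, hvu, hux⟩
  · exact ⟨[v], by simp, by simp, by simp, by simp; tauto, by simp, by simpa using hv,
      by simpa using hvx⟩
  · refine ⟨[v, u], by simp, by simp, by simpa using huv.symm, ?_, by simpa using hvu,
      by simpa using hv, by simpa using hux⟩
    simp only [List.mem_cons, List.not_mem_nil, or_false]
    rintro z (rfl | rfl) <;> tauto

/-- The new piece to be appended. -/
lemma piece {col : ℕ → ℕ → Fin 3} (hs : ∀ a b, col a b = col b a) {i j k : Fin 3}
    {F : Finset ℕ} {c N0 : ℕ} (hl : LinkProp col i j k F c N0)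
    (L : ℕ) (A B : Finset ℕ) (hd : Disjoint A B)
    (hA : ∀ a ∈ A, (B.filter (fun b => col a b ≠ k)).card ≤ 5)
    (hB : ∀ b ∈ B, (A.filter (fun a => col b a ≠ k)).card ≤ 5)
    (cA : L + 20 ≤ A.card) (cB : L + 20 ≤ B.card)
    (vA : ∀ x ∈ A, x ∈ VV col i ∧ N0 ≤ x) (vB : ∀ x ∈ B, x ∈ VV col j ∧ N0 ≤ x)
    (G : Finset ℕ) (hG : G.card + 2 ≤ c) :
    ∃ w p w' : List ℕ, (w ++ p ++ w').Nodup ∧ w.length ≤ 2 ∧ w'.length ≤ 2 ∧ L ≤ p.length ∧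
      (∀ z ∈ p, z ∈ A ∪ B) ∧ (∀ z ∈ w ++ w', z < N0 ∧ z ∉ F ∧ z ∉ G) ∧
      (w ++ p ++ w').IsChain (fun a b => col a b = k) ∧
      (∀ z ∈ (w ++ p ++ w').head?, z ∈ VV col k) ∧
      (∀ z ∈ (w ++ p ++ w').getLast?, z ∈ VV col k) := by
  have nA : A.Nonempty := Finset.card_pos.1 (by omega)
  have nB : B.Nonempty := Finset.card_pos.1 (by omega)
  obtain ⟨x, hx, w, a1, a2, a3, a4, a5, a6, a7⟩ := hl A B nA nB vA vB G (by omega)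
  have hcG : (G ∪ w.toFinset).card ≤ c := by
    have h1 := Finset.card_union_le G w.toFinset
    have h2 := List.toFinset_card_le w
    omega
  have nA' : (A.erase x).Nonempty := by
    apply Finset.card_pos.1
    have := Finset.pred_card_le_card_erase (s := A) (a := x)
    omega
  have nB' : (B.erase x).Nonempty := by
    apply Finset.card_pos.1
    have := Finset.pred_card_le_card_erase (s := B) (a := x)
    omega
  obtain ⟨x', hx', w', b1, b2, b3, b4, b5, b6, b7⟩ := hl _ _ nA' nB'
    (fun z hz => vA z (Finset.mem_of_mem_erase hz)) (fun z hz => vB z (Finset.mem_of_mem_erase hz))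
    _ hcG
  have hx'' : x' ∈ A ∪ B ∧ x ≠ x' := by
    simp only [Finset.mem_union, Finset.mem_erase] at hx' ⊢
    exact ⟨by tauto, by rintro rfl; tauto⟩
  obtain ⟨p, p1, p2, p3, p4, p5, p6⟩ := path_lemma hs k L A B hd hA hB cA cB x hx x' hx''.1 hx''.2
  have hpN : ∀ z ∈ p, N0 ≤ z := by
    intro z hz
    rcases Finset.mem_union.1 (p2 z hz) with h | h
    · exact (vA z h).2
    · exact (vB z h).2
  refine ⟨w, p, w'.reverse, ?_, a2, by simpa using b2, p6, p2, ?_, ?_, ?_, ?_⟩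
  · rw [List.nodup_append, List.nodup_append]
    refine ⟨⟨a3, p1, ?_⟩, by simpa using b3, ?_⟩
    · intro a ha b hb h
      have := (a4 a ha).1
      have := hpN b hb
      omega
    · intro a ha b hb h
      rw [List.mem_reverse] at hb
      subst h
      rcases List.mem_append.1 ha with ha | ha
      · have := (b4 a hb).2.2
        simp only [Finset.mem_union, List.mem_toFinset, not_or] at this
        exact this.2 ha
      · have := (b4 a hb).1
        have := hpN a ha
        omega
  · intro z hz
    rcases List.mem_append.1 hz with hz | hz
    · exact a4 z hz
    · rw [List.mem_reverse] at hz
      have := b4 z hz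
      simp only [Finset.mem_union, not_or] at this
      tauto
  · rw [List.isChain_append, List.isChain_append]
    refine ⟨⟨a5, p3, ?_⟩, ?_, ?_⟩
    · intro a ha b hb
      rw [p4] at hb
      simp only [Option.mem_some_iff] at hb
      exact hb ▸ a7 a ha
    · rw [List.isChain_reverse]
      exact b5.imp (fun a b h => by rw [hs]; exact h)
    · intro a ha b hb
      rw [List.getLast?_append, p5] at ha
      simp only [Option.some_or, Option.mem_some_iff] at ha
      rw [List.head?_reverse] at hb
      rw [hs]
      exact ha ▸ b7 b hb
  · intro z hz
    rw [List.append_assoc, List.head?_append_of_ne_nil _ a1] at hz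
    exact a6 z hz
  · intro z hz
    rw [List.getLast?_append_of_ne_nil _ (by simpa using b1), List.getLast?_reverse] at hz
    exact b6 z hz

end MP

namespace MP

lemma Adm.append {col : ℕ → ℕ → Fin 3} {i : Fin 3} {L : Set ℕ} {F : Finset ℕ} {l m : List ℕ}
    (hl : Adm col i L F l) (hm : Adm col i L F m) (hd : ∀ x ∈ l, x ∉ m) :
    Adm col i L F (l ++ m) := by
  refine ⟨?_, ?_, ?_, ?_, ?_⟩
  · rw [List.nodup_append]
    exact ⟨hl.nodup, hm.nodup, fun a ha b hb h => hd a ha (h ▸ hb)⟩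
  · intro x hx
    rcases List.mem_append.1 hx with h | h
    · exact hl.avoid x h
    · exact hm.avoid x h
  · rw [List.isChain_append]
    exact ⟨hl.chain, hm.chain, fun x hx y hy => Or.inl ⟨hl.tl x hx, hm.hd y hy⟩⟩
  · intro x hx
    cases l with
    | nil => exact hm.hd x (by simpa using hx)
    | cons a l => exact hl.hd x (by simpa using hx)
  · intro x hx
    rw [List.getLast?_append] at hx
    cases h : m.getLast? with
    | none => rw [h] at hx; exact hl.tl x (by simpa using hx)
    | some b => rw [h] at hx; exact hm.tl x (by rw [h]; simpa using hx)

/-- The state of the finite construction. -/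
structure Inv (col : ℕ → ℕ → Fin 3) (F : Finset ℕ) (N0 n L s : ℕ) (l : Fin 3 → List ℕ) :
    Prop where
  adm : ∀ i, Adm col i (VV col i) F (l i)
  lt : ∀ i, ∀ x ∈ l i, x < n
  hi : ∀ i, ∀ x ∈ l i, N0 ≤ x → x ∉ VV col i
  low : ∀ i, ((l i).toFinset.filter (· < N0)).card ≤ 4 * s
  sum : s * L ≤ ∑ i, ((l i).toFinset.filter (N0 ≤ ·)).card

lemma arith (v0 v1 v2 a01 a02 a10 a12 a20 a21 o0 o1 o2 x0 x1 x2 e012 e021 e102 e120 e201 e210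
    n N0 L : ℕ)
    (hx0 : a10 + a20 ≤ x0) (hx1 : a01 + a21 ≤ x1) (hx2 : a02 + a12 ≤ x2)
    (h0 : 2 * (x0 + v0 + o0) + 4 * L < n) (h1 : 2 * (x1 + v1 + o1) + 4 * L < n)
    (h2 : 2 * (x2 + v2 + o2) + 4 * L < n) (hn : n ≤ N0 + (v0 + v1 + v2))
    (h012 : v0 ≤ e012 + a01 + a02 + o0 + o1)
    (h021 : v0 ≤ e021 + a02 + a01 + o0 + o2)
    (h102 : v1 ≤ e102 + a10 + a12 + o1 + o0)
    (h120 : v1 ≤ e120 + a12 + a10 + o1 + o2)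
    (h201 : v2 ≤ e201 + a20 + a21 + o2 + o0)
    (h210 : v2 ≤ e210 + a21 + a20 + o2 + o1) :
    (4 * L ≤ e012 + N0 ∧ 4 * L ≤ e102 + N0) ∨ (4 * L ≤ e021 + N0 ∧ 4 * L ≤ e201 + N0) ∨
    (4 * L ≤ e120 + N0 ∧ 4 * L ≤ e210 + N0) := by
  by_contra hcon
  simp only [not_or, not_and_or, not_le] at hcon
  obtain ⟨c1 | c1, c2 | c2, c3 | c3⟩ := hcon <;> omega

set_option maxHeartbeats 1000000 in
lemma inv_step {col : ℕ → ℕ → Fin 3} (hs : ∀ a b, col a b = col b a) {F : Finset ℕ}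
    {N0 n L s c : ℕ} (hF : ∀ x ∈ F, x < N0) (hN0 : N0 ≤ n) (hL : N0 + 100 ≤ L)
    (hsc : 4 * s + 2 ≤ c)
    (hlink : ∀ i j k : Fin 3, i ≠ j → i ≠ k → j ≠ k → LinkProp col i j k F c N0)
    (hbad : ∀ i l, Adm col i (VV col i) F l →
      2 * (l.toFinset.filter (· < n)).card + 4 * L < n)
    {l : Fin 3 → List ℕ} (hl : Inv col F N0 n L s l) : ∃ l', Inv col F N0 n L (s+1) l' := by
  classical
  set S : Fin 3 → Finset ℕ := fun i => (Finset.Ico N0 n).filter (fun x => x ∈ VV col i) with hS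
  set R : Fin 3 → Finset ℕ := fun i => (Finset.Ico N0 n).filter
    (fun x => x ∉ VV col i ∧ x ∉ l i) with hR
  have mS : ∀ i x, x ∈ S i ↔ (N0 ≤ x ∧ x < n) ∧ x ∈ VV col i := by
    intro i x; simp [hS]
  have mR : ∀ i x, x ∈ R i ↔ (N0 ≤ x ∧ x < n) ∧ x ∉ VV col i ∧ x ∉ l i := by
    intro i x; simp [hR]
  have hSR : ∀ i, Disjoint (S i) (R i) := by
    intro i
    rw [Finset.disjoint_left]
    intro x h1 h2
    exact ((mR i x).1 h2).2.1 ((mS i x).1 h1).2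
  have hfor := fun i => forest hs i (VV col i) (S i) (R i) (fun x hx => ((mS i x).1 hx).2) (hSR i)
  choose m O hOS mhd mnd mmem mS' mtl mch hOc hdeg using hfor
  set C : Fin 3 → Finset ℕ := fun i => (m i).toFinset ∩ R i with hC
  have madm : ∀ i, Adm col i (VV col i) F (m i) := by
    intro i
    refine ⟨mnd i, ?_, mch i, fun x hx => ((mS i x).1 (mhd i x hx)).2,
      fun x hx => ((mS i x).1 (mtl i x hx)).2⟩
    intro x hx hxF
    have := hF x hxF
    rcases Finset.mem_union.1 (mmem i x hx) with h | h
    · have := ((mS i x).1 h).1.1; omega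
    · have := ((mR i x).1 h).1.1; omega
  have hdis : ∀ i, ∀ x ∈ l i, x ∉ m i := by
    intro i x hx hxm
    rcases Finset.mem_union.1 (mmem i x hxm) with h | h
    · have h := (mS i x).1 h
      exact hl.hi i x hx h.1.1 h.2
    · exact ((mR i x).1 h).2.2 hx
  have fact2 : ∀ i, 2 * (((l i).toFinset.filter (N0 ≤ ·)).card + (S i).card + (O i).card) + 4 * L
      < n := by
    intro i
    refine lt_of_le_of_lt ?_ (hbad i _ ((hl.adm i).append (madm i) (hdis i)))
    have e1 : Disjoint ((l i).toFinset.filter (N0 ≤ ·)) (S i) := by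
      rw [Finset.disjoint_left]
      intro x h1 h2
      rw [Finset.mem_filter, List.mem_toFinset] at h1
      exact hl.hi i x h1.1 h1.2 ((mS i x).1 h2).2
    have e2 : Disjoint ((l i).toFinset.filter (N0 ≤ ·) ∪ S i) (C i) := by
      rw [Finset.disjoint_left]
      intro x h1 h2
      have h2' := (mR i x).1 (Finset.mem_inter.1 h2).2
      rcases Finset.mem_union.1 h1 with h1 | h1
      · rw [Finset.mem_filter, List.mem_toFinset] at h1
        exact h2'.2.2 h1.1
      · exact h2'.2.1 ((mS i x).1 h1).2
    rw [hOc, ← Finset.card_union_of_disjoint e1, ← Finset.card_union_of_disjoint e2]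
    gcongr
    intro x hx
    simp only [Finset.mem_filter, List.mem_toFinset, List.mem_append]
    rcases Finset.mem_union.1 hx with hx | hx
    · rcases Finset.mem_union.1 hx with hx | hx
      · rw [Finset.mem_filter, List.mem_toFinset] at hx
        exact ⟨Or.inl hx.1, hl.lt i x hx.1⟩
      · exact ⟨Or.inr (mS' i x hx), ((mS i x).1 hx).1.2⟩
    · rw [Finset.mem_inter, List.mem_toFinset] at hx
      exact ⟨Or.inr hx.1, ((mR i x).1 hx.2).1.2⟩
  have fact1 : ∀ i j k : Fin 3, j ≠ k →
      (S j ∩ (l i).toFinset).card + (S k ∩ (l i).toFinset).card ≤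
        ((l i).toFinset.filter (N0 ≤ ·)).card := by
    intro i j k hjk
    have : Disjoint (S j ∩ (l i).toFinset) (S k ∩ (l i).toFinset) := by
      rw [Finset.disjoint_left]
      intro x h1 h2
      exact hjk (VV_unique ((mS j x).1 (Finset.mem_inter.1 h1).1).2
        ((mS k x).1 (Finset.mem_inter.1 h2).1).2)
    rw [← Finset.card_union_of_disjoint this]
    apply Finset.card_le_card
    intro x hx
    rw [Finset.mem_filter]
    rcases Finset.mem_union.1 hx with hx | hx
    · exact ⟨(Finset.mem_inter.1 hx).2, ((mS j x).1 (Finset.mem_inter.1 hx).1).1.1⟩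
    · exact ⟨(Finset.mem_inter.1 hx).2, ((mS k x).1 (Finset.mem_inter.1 hx).1).1.1⟩
  have fact3 : n ≤ N0 + ((S 0).card + (S 1).card + (S 2).card) := by
    have h1 : Finset.Ico N0 n ⊆ S 0 ∪ S 1 ∪ S 2 := by
      intro x hx
      rw [Finset.mem_Ico] at hx
      obtain ⟨a, ha⟩ := VV_exists col x
      simp only [Finset.mem_union, mS]
      rcases fin3 (i := 0) (j := 1) (k := 2) (by decide) (by decide) (by decide) a
        with rfl | rfl | rfl <;> tauto
    have h2 := Finset.card_le_card h1
    have h3 := Finset.card_union_le (S 0 ∪ S 1) (S 2)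
    have h4 := Finset.card_union_le (S 0) (S 1)
    rw [Nat.card_Ico] at h2
    omega
  set E : Fin 3 → Fin 3 → Fin 3 → Finset ℕ := fun i j k =>
    (S i).filter (fun x => x ∉ l j ∧ x ∉ l k ∧ x ∉ O i ∧ x ∉ C j) with hE
  have mE : ∀ i j k x, x ∈ E i j k ↔ x ∈ S i ∧ x ∉ l j ∧ x ∉ l k ∧ x ∉ O i ∧ x ∉ C j := by
    intro i j k x; simp only [hE, Finset.mem_filter]
  have fact4 : ∀ i j k, (S i).card ≤ (E i j k).card + (S i ∩ (l j).toFinset).card +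
      (S i ∩ (l k).toFinset).card + (O i).card + (O j).card := by
    intro i j k
    have h1 : S i ⊆ E i j k ∪ (S i ∩ (l j).toFinset) ∪ (S i ∩ (l k).toFinset) ∪ O i ∪ C j := by
      intro x hx
      simp only [Finset.mem_union, mE, Finset.mem_inter, List.mem_toFinset, hx, true_and]
      tauto
    have h2 := Finset.card_le_card h1
    have h3 := Finset.card_union_le (E i j k ∪ (S i ∩ (l j).toFinset) ∪ (S i ∩ (l k).toFinset) ∪ O i) (C j)
    have h4 := Finset.card_union_le (E i j k ∪ (S i ∩ (l j).toFinset) ∪ (S i ∩ (l k).toFinset)) (O i)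
    have h5 := Finset.card_union_le (E i j k ∪ (S i ∩ (l j).toFinset)) (S i ∩ (l k).toFinset)
    have h6 := Finset.card_union_le (E i j k) (S i ∩ (l j).toFinset)
    have h7 : (O j).card = (C j).card := hOc j
    omega
  have hex : ∃ i j k : Fin 3, i ≠ j ∧ i ≠ k ∧ j ≠ k ∧ 4 * L ≤ (E i j k).card + N0 ∧
      4 * L ≤ (E j i k).card + N0 := by
    rcases arith _ _ _ _ _ _ _ _ _ _ _ _ _ _ _ _ _ _ _ _ _ n N0 L (fact1 0 1 2 (by decide))
      (fact1 1 0 2 (by decide)) (fact1 2 0 1 (by decide)) (fact2 0) (fact2 1) (fact2 2) fact3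
      (fact4 0 1 2) (fact4 0 2 1) (fact4 1 0 2) (fact4 1 2 0) (fact4 2 0 1) (fact4 2 1 0)
      with h | h | h
    · exact ⟨0, 1, 2, by decide, by decide, by decide, h⟩
    · exact ⟨0, 2, 1, by decide, by decide, by decide, h⟩
    · exact ⟨1, 2, 0, by decide, by decide, by decide, h⟩
  obtain ⟨i, j, k, hij, hik, hjk, hc1, hc2⟩ := hex
  -- degree conditions
  have deg : ∀ i j k : Fin 3, i ≠ j → ∀ y ∈ E j i k,
      ((E i j k).filter (fun x => col x y = i)).card ≤ 1 := by
    intro i j k hij y hy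
    rw [mE] at hy
    have hyR : y ∈ R i := by
      rw [mR]
      have h := (mS j y).1 hy.1
      exact ⟨h.1, fun h' => hij (VV_unique h' h.2), hy.2.1⟩
    have hym : y ∉ m i := fun h => hy.2.2.2.2 (Finset.mem_inter.2 ⟨List.mem_toFinset.2 h, hyR⟩)
    refine le_trans (Finset.card_le_card (Finset.filter_subset_filter _ ?_)) (hdeg i y hyR hym)
    intro x hx
    rw [mE] at hx
    exact Finset.mem_sdiff.2 ⟨hx.1, hx.2.2.2.1⟩
  obtain ⟨A, B, hAE, hBE, cA, cB, dA, dB⟩ := clean hs hij hik hjk (4 * L - N0) (E i j k) (E j i k)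
    (deg i j k hij) (deg j i k hij.symm) (by omega) (by omega)
  have vA : ∀ x ∈ A, x ∈ S i ∧ x ∉ l k := fun x hx =>
    ⟨((mE _ _ _ _).1 (hAE hx)).1, ((mE _ _ _ _).1 (hAE hx)).2.2.1⟩
  have vB : ∀ x ∈ B, x ∈ S j ∧ x ∉ l k := fun x hx =>
    ⟨((mE _ _ _ _).1 (hBE hx)).1, ((mE _ _ _ _).1 (hBE hx)).2.2.1⟩
  have hAB : Disjoint A B := by
    rw [Finset.disjoint_left]
    intro x h1 h2
    exact hij (VV_unique ((mS i x).1 (vA x h1).1).2 ((mS j x).1 (vB x h2).1).2)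
  obtain ⟨w, p, w', q1, q2, q3, q4, q5, q6, q7, q8, q9⟩ := piece hs (hlink i j k hij hik hjk) L A B
    hAB dA dB (by omega) (by omega)
    (fun x hx => ⟨((mS i x).1 (vA x hx).1).2, ((mS i x).1 (vA x hx).1).1.1⟩)
    (fun x hx => ⟨((mS j x).1 (vB x hx).1).2, ((mS j x).1 (vB x hx).1).1.1⟩)
    ((l k).toFinset.filter (· < N0)) (by have := hl.low k; omega)
  have hp : ∀ z ∈ p, (N0 ≤ z ∧ z < n) ∧ z ∉ VV col k ∧ z ∉ l k := by
    intro z hz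
    rcases Finset.mem_union.1 (q5 z hz) with h | h
    · have h1 := (mS i z).1 (vA z h).1
      exact ⟨h1.1, fun h' => hik (VV_unique h1.2 h'), (vA z h).2⟩
    · have h1 := (mS j z).1 (vB z h).1
      exact ⟨h1.1, fun h' => hjk (VV_unique h1.2 h'), (vB z h).2⟩
  have hw : ∀ z ∈ w ++ w', z < N0 ∧ z ∉ F ∧ z ∉ l k := by
    intro z hz
    have h := q6 z hz
    refine ⟨h.1, h.2.1, fun h' => h.2.2 ?_⟩
    rw [Finset.mem_filter, List.mem_toFinset]
    exact ⟨h', h.1⟩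
  set t := w ++ p ++ w' with ht
  have mt : ∀ z, z ∈ t ↔ z ∈ p ∨ z ∈ w ++ w' := by
    intro z; simp only [ht, List.mem_append]; tauto
  have tadm : Adm col k (VV col k) F t := by
    refine ⟨q1, ?_, q7.imp (fun a b h => Or.inr h), q8, q9⟩
    intro x hx hxF
    rcases (mt x).1 hx with h | h
    · have := hF x hxF
      have := (hp x h).1.1
      omega
    · exact (hw x h).2.1 hxF
  have htl : ∀ x ∈ l k, x ∉ t := by
    intro x hx hxt
    rcases (mt x).1 hxt with h | h
    · exact (hp x h).2.2 hx
    · exact (hw x h).2.2 hx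
  refine ⟨Function.update l k (l k ++ t), ?_, ?_, ?_, ?_, ?_⟩
  · intro a
    by_cases hak : a = k
    · subst hak
      rw [Function.update_self]
      exact (hl.adm a).append tadm htl
    · rw [Function.update_of_ne hak]; exact hl.adm a
  · intro a x hx
    by_cases hak : a = k
    · subst hak
      rw [Function.update_self] at hx
      rcases List.mem_append.1 hx with h | h
      · exact hl.lt a x h
      · rcases (mt x).1 h with h | h
        · exact (hp x h).1.2
        · have := (hw x h).1; omega
    · rw [Function.update_of_ne hak] at hx; exact hl.lt a x hx
  · intro a x hx hxN
    by_cases hak : a = k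
    · subst hak
      rw [Function.update_self] at hx
      rcases List.mem_append.1 hx with h | h
      · exact hl.hi a x h hxN
      · rcases (mt x).1 h with h | h
        · exact (hp x h).2.1
        · have := (hw x h).1; omega
    · rw [Function.update_of_ne hak] at hx; exact hl.hi a x hx hxN
  · intro a
    by_cases hak : a = k
    · subst hak
      rw [Function.update_self]
      have h1 : (l a ++ t).toFinset.filter (· < N0) ⊆
          (l a).toFinset.filter (· < N0) ∪ (w ++ w').toFinset := by
        intro x hx
        rw [Finset.mem_filter, List.mem_toFinset, List.mem_append] at hx
        rw [Finset.mem_union, Finset.mem_filter, List.mem_toFinset, List.mem_toFinset]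
        rcases hx.1 with h | h
        · exact Or.inl ⟨h, hx.2⟩
        · rcases (mt x).1 h with h | h
          · have := (hp x h).1; omega
          · exact Or.inr h
      have h2 := (Finset.card_le_card h1).trans (Finset.card_union_le _ _)
      have h3 := List.toFinset_card_le (w ++ w')
      have h4 := hl.low a
      rw [List.length_append] at h3
      omega
    · rw [Function.update_of_ne hak]
      have := hl.low a
      omega
  · have key : ∀ a ∈ Finset.univ, ((l a).toFinset.filter (N0 ≤ ·)).card + (if a = k then L else 0) ≤
        ((Function.update l k (l k ++ t) a).toFinset.filter (N0 ≤ ·)).card := by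
      intro a _
      by_cases hak : a = k
      · subst hak
        rw [Function.update_self, if_pos rfl]
        have e1 : Disjoint ((l a).toFinset.filter (N0 ≤ ·)) p.toFinset := by
          rw [Finset.disjoint_left]
          intro x h1 h2
          rw [Finset.mem_filter, List.mem_toFinset] at h1
          rw [List.mem_toFinset] at h2
          exact (hp x h2).2.2 h1.1
        have hpn : p.Nodup := q1.of_append_left.of_append_right
        have h2 : p.toFinset.card = p.length := List.toFinset_card_of_nodup hpn
        have h3 : (l a).toFinset.filter (N0 ≤ ·) ∪ p.toFinset ⊆
            (l a ++ t).toFinset.filter (N0 ≤ ·) := by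
          intro x hx
          rw [Finset.mem_union, Finset.mem_filter, List.mem_toFinset, List.mem_toFinset] at hx
          rw [Finset.mem_filter, List.mem_toFinset, List.mem_append, mt]
          rcases hx with h | h
          · exact ⟨Or.inl h.1, h.2⟩
          · exact ⟨Or.inr (Or.inl h), (hp x h).1.1⟩
        have h4 := Finset.card_le_card h3
        rw [Finset.card_union_of_disjoint e1] at h4
        omega
      · rw [Function.update_of_ne hak, if_neg hak]; simp
    have h1 := Finset.sum_le_sum key
    rw [Finset.sum_add_distrib, Finset.sum_ite_eq' Finset.univ k (fun _ => L)] at h1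
    simp only [Finset.mem_univ, if_true] at h1
    have := hl.sum
    rw [Nat.succ_mul]
    omega

lemma exists_good {col : ℕ → ℕ → Fin 3} (hs : ∀ a b, col a b = col b a) (hNC : NC col) :
    ∃ i, Good col i (VV col i) := by
  by_contra hcon
  push Not at hcon
  simp only [Good, not_forall, not_exists, not_and, not_le] at hcon
  choose F' D' N' hD' h' using hcon
  set F : Finset ℕ := Finset.univ.biUnion F' with hF
  set D : ℕ := ∏ i, D' i with hD
  set K : ℕ := 12 * D + 1 with hK
  have hlk : ∀ t : Fin 3 × Fin 3 × Fin 3, ∃ N, t.1 ≠ t.2.1 → t.1 ≠ t.2.2 → t.2.1 ≠ t.2.2 →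
      LinkProp col t.1 t.2.1 t.2.2 F (4 * K + 4) N := by
    rintro ⟨i, j, k⟩
    by_cases h : i ≠ j ∧ i ≠ k ∧ j ≠ k
    · obtain ⟨N, hN⟩ := exists_linkProp hs hNC h.1 h.2.1 h.2.2 F (4 * K + 4)
      exact ⟨N, fun _ _ _ => hN⟩
    · exact ⟨0, fun a b c => absurd ⟨a, b, c⟩ h⟩
  choose Nf hNf using hlk
  set N0 : ℕ := Finset.univ.sup Nf + F.sup id + 1 with hN0
  set L : ℕ := N0 + 100 + ∑ i, N' i with hL
  have hDpos : 0 < D := Finset.prod_pos (fun i _ => hD' i)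
  set n : ℕ := 4 * D * L with hn
  have hLn : 4 * L ≤ n := by
    rw [hn]; nlinarith
  have hD'le : ∀ i, D' i ≤ D := fun i => Nat.le_of_dvd hDpos (Finset.dvd_prod_of_mem _ (Finset.mem_univ i))
  have hbad : ∀ i l, Adm col i (VV col i) F l →
      2 * (l.toFinset.filter (· < n)).card + 4 * L < n := by
    intro i l hl
    have hN'le : N' i ≤ ∑ i, N' i := Finset.single_le_sum (fun _ _ => Nat.zero_le _) (Finset.mem_univ i)
    have h1 := h' i n (by omega) l ⟨hl.nodup, fun x hx hx' => hl.avoid x hx (by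
      rw [hF, Finset.mem_biUnion]; exact ⟨i, Finset.mem_univ i, hx'⟩), hl.chain, hl.hd, hl.tl⟩
    have h2 : 4 * L ≤ n / D' i := by
      rw [Nat.le_div_iff_mul_le (hD' i)]
      calc 4 * L * D' i ≤ 4 * L * D := Nat.mul_le_mul_left _ (hD'le i)
        _ = n := by rw [hn]; ring
    omega
  have hinv : ∀ s, s ≤ K → ∃ l, Inv col F N0 n L s l := by
    intro s
    induction s with
    | zero =>
      intro _
      exact ⟨fun _ => [], fun i => ⟨by simp, by simp, by simp, by simp, by simp⟩, by simp, by simp,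
        by simp, by simp⟩
    | succ s ih =>
      intro hsK
      obtain ⟨l, hl⟩ := ih (by omega)
      refine inv_step hs (c := 4 * K + 4) ?_ (by omega) (by omega) (by omega) ?_ hbad hl
      · intro x hx
        have : x ≤ F.sup id := Finset.le_sup (f := id) hx
        omega
      · intro i j k a b c
        refine (hNf (i, j, k) a b c).mono ?_
        have := Finset.le_sup (f := Nf) (Finset.mem_univ (i, j, k))
        omega
  obtain ⟨l, hl⟩ := hinv K le_rfl
  have h1 : ∑ i, ((l i).toFinset.filter (N0 ≤ ·)).card ≤ ∑ i : Fin 3, n := by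
    apply Finset.sum_le_sum
    intro i _
    have : (l i).toFinset.filter (N0 ≤ ·) ⊆ Finset.range n := by
      intro x hx
      rw [Finset.mem_filter, List.mem_toFinset] at hx
      exact Finset.mem_range.2 (hl.lt i x hx.1)
    simpa using Finset.card_le_card this
  have h2 := hl.sum
  have h3 : K * L = 3 * n + L := by rw [hK, hn]; ring
  simp only [Finset.sum_const, Finset.card_univ, Fintype.card_fin, smul_eq_mul] at h1
  omega

theorem core {col : ℕ → ℕ → Fin 3} (hs : ∀ a b, col a b = col b a) :
    ∃ (i : Fin 3) (f : ℕ → ℕ), Function.Injective f ∧ (∀ j, col (f j) (f (j+1)) = i) ∧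
      ∀ k, ∃ n, k ≤ n ∧ ∃ A : Finset ℕ, (∀ x ∈ A, x < n ∧ x ∈ Set.range f) ∧
        n ≤ 2 * A.card + n / (k+2) := by
  by_cases hNC : NC col
  · obtain ⟨i, hi⟩ := exists_good hs hNC
    exact ⟨i, infinite_path hs (VV_linked hs i) hi⟩
  · simp only [NC, not_forall, not_not] at hNC
    obtain ⟨i, j, S, T, hS, hT, hST⟩ := hNC
    rcases good_of_cover (col := col) (i := i) (j := j) hST with h | h
    · exact ⟨i, infinite_path hs hS h⟩
    · exact ⟨j, infinite_path hs hT h⟩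

end MP

namespace MP
lemma card_le_aux (A : Set ℕ+) (n : ℕ) : Nat.card {a : ℕ+ // a ∈ A ∧ (a : ℕ) ≤ n} ≤ n := by
  have : Function.Injective (fun a : {a : ℕ+ // a ∈ A ∧ (a : ℕ) ≤ n} =>
      (⟨a.1.natPred, by
        have h1 := a.2.2
        have := PNat.natPred_add_one a.1
        omega⟩ : Fin n)) := by
    intro a b hab
    simp only [Fin.mk.injEq] at hab
    exact Subtype.ext (PNat.natPred_injective hab)
  simpa using Nat.card_le_card_of_injective _ this

lemma density_of_path (f : ℕ → ℕ)
    (h : ∀ k, ∃ n, k ≤ n ∧ ∃ A : Finset ℕ, (∀ x ∈ A, x < n ∧ x ∈ Set.range f) ∧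
        n ≤ 2 * A.card + n / (k+2)) :
    1 / 2 ≤ upperDensity (Set.range (fun j => (f j).succPNat)) := by
  set S := Set.range (fun j => (f j).succPNat) with hS
  have hle1 : ∀ n : ℕ, (Nat.card {a : ℕ+ // a ∈ S ∧ (a : ℕ) ≤ n} : ℝ) / n ≤ 1 := by
    intro n
    have := card_le_aux S n
    apply div_le_one_of_le₀ _ (Nat.cast_nonneg _)
    exact_mod_cast this
  rw [upperDensity]
  apply le_of_forall_lt
  intro b hb
  obtain ⟨b', hb', hb''⟩ := exists_between hb
  refine lt_of_lt_of_le hb' ?_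
  apply le_limsup_of_frequently_le
  · rw [frequently_atTop]
    intro N
    obtain ⟨m, hm⟩ := exists_nat_gt (1 / (1/2 - b'))
    have hpos : 0 < 1/2 - b' := by linarith
    obtain ⟨n, hn, A, hA, hc⟩ := h (N + m + 1)
    refine ⟨n, by omega, ?_⟩
    have hfin : Finite {a : ℕ+ // a ∈ S ∧ (a : ℕ) ≤ n} := by
      have : Function.Injective (fun a : {a : ℕ+ // a ∈ S ∧ (a : ℕ) ≤ n} =>
          (⟨(a.1 : ℕ), by have := a.2.2; omega⟩ : Fin (n+1))) := by
        intro a b hab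
        simp only [Fin.mk.injEq] at hab
        exact Subtype.ext (PNat.coe_injective hab)
      exact Finite.of_injective _ this
    have hcard : A.card ≤ Nat.card {a : ℕ+ // a ∈ S ∧ (a : ℕ) ≤ n} := by
      have hinj : Function.Injective (fun x : A =>
          (⟨(x.1).succPNat, by
            obtain ⟨h1, j, hj⟩ := hA x.1 x.2
            refine ⟨⟨j, by rw [← hj]⟩, ?_⟩
            simp; omega⟩ : {a : ℕ+ // a ∈ S ∧ (a : ℕ) ≤ n})) := by
        intro a b hab
        simp only [Subtype.mk.injEq] at hab
        exact Subtype.ext (Nat.succPNat_injective hab)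
      simpa using Nat.card_le_card_of_injective _ hinj
    have hn0 : (0:ℝ) < n := by exact_mod_cast (by omega : 0 < n)
    rw [le_div_iff₀ hn0]
    have h1 : (n : ℝ) ≤ 2 * A.card + (n / (N + m + 1 + 2) : ℕ) := by exact_mod_cast hc
    have h2 : ((n / (N + m + 1 + 2) : ℕ) : ℝ) ≤ n / ((N + m + 1 + 2 : ℕ) : ℝ) := Nat.cast_div_le
    have h3 : (n : ℝ) / ((N + m + 1 + 2 : ℕ) : ℝ) ≤ n * (1/2 - b') := by
      rw [div_le_iff₀ (by positivity), mul_assoc]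
      have : (m : ℝ) ≤ ((N + m + 1 + 2 : ℕ) : ℝ) := by exact_mod_cast (by omega)
      have h4 : 1 ≤ (1/2 - b') * ((N + m + 1 + 2 : ℕ) : ℝ) := by
        rw [div_lt_iff₀ hpos] at hm
        nlinarith
      nlinarith
    have h5 : (A.card : ℝ) ≤ Nat.card {a : ℕ+ // a ∈ S ∧ (a : ℕ) ≤ n} := by exact_mod_cast hcard
    nlinarith
  · exact isBoundedUnder_of ⟨1, hle1⟩

end MP

/-- In any 3-edge-colouring of `K_ℕ`, there is a monochromatic path of upper
density at least `1/2`. -/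
theorem stmt_0 (c : Sym2 ℕ+ → Fin 3) :
    ∃ (i : Fin 3) (P : Set ℕ+),
      IsMonoPath completeAdj c i P ∧ 1 / 2 ≤ upperDensity P := by
  obtain ⟨i, f, hf, hcol, hd⟩ := MP.core (col := fun a b => c s(a.succPNat, b.succPNat))
    (fun a b => by rw [Sym2.eq_swap])
  refine ⟨i, Set.range (fun j => (f j).succPNat), Or.inr ⟨fun j => (f j).succPNat, ?_, ?_, rfl⟩,
    MP.density_of_path f hd⟩
  · exact Nat.succPNat_injective.comp hf
  · intro j
    refine ⟨?_, hcol j⟩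
    intro h
    have := hf (Nat.succPNat_injective h)
    omega
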